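/- (Adaptive confidence band, coverage.) Under the stated assumptions, for every α ∈ (0,1) there exist a constant C > 0 and N₀ such that for all n ≥ N₀, Pⁿ( for all t ∈ [t₁,t₂]: λ̄_n(t) − Q̂_α(λ_1,…,λ_n) σ̂_n(t)/√n ≤ μ(t) ≤ λ̄_n(t) + Q̂_α(λ_1,…,λ_n) σ̂_n(t)/√n ) ≥ 1 − α − C (log n)^{1/2} n^{−1/8}. -/

import Mathlib

open MeasureTheory ProbabilityTheory Set Filter

noncomputable section

/-- A landscape-type function for `T`: 1-Lipschitz, with values in `[0, T/2]`,
and vanishing outside `[0, T]`. -/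
def IsLandscapeType (T : ℝ) (f : ℝ → ℝ) : Prop :=
  LipschitzWith 1 f ∧ (∀ t, 0 ≤ f t ∧ f t ≤ T / 2) ∧ ∀ t ∉ Set.Icc (0 : ℝ) T, f t = 0

/-- The Borel σ-algebra on the space `C(ℝ, ℝ)` of continuous functions with the
topology of uniform convergence on compact sets (the compact-open topology). -/
instance : MeasurableSpace C(ℝ, ℝ) := borel _

instance : BorelSpace C(ℝ, ℝ) := ⟨rfl⟩

/-- The mean function `μ(t) = ∫ λ(t) dP(λ)`. -/
def lmean (P : Measure C(ℝ, ℝ)) (t : ℝ) : ℝ := ∫ f, f t ∂P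

/-- The variance function `σ(t)² = ∫ λ(t)² dP(λ) − μ(t)²`. -/
def lvar (P : Measure C(ℝ, ℝ)) (t : ℝ) : ℝ := (∫ f, (f t) ^ 2 ∂P) - (lmean P t) ^ 2

/-- The standard deviation function `σ(t)`. -/
def lsd (P : Measure C(ℝ, ℝ)) (t : ℝ) : ℝ := Real.sqrt (lvar P t)

/-- The empirical average `λ̄_n(t) = (1/n) Σ_i λ_i(t)` of a tuple of functions. -/
def empMean (n : ℕ) (l : Fin n → C(ℝ, ℝ)) (t : ℝ) : ℝ := (∑ i, l i t) / n

/-- The empirical standard deviation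
`σ̂_n(t) = sqrt((1/n) Σ_i λ_i(t)² − λ̄_n(t)²)` of a tuple of functions. -/
def empSD (n : ℕ) (l : Fin n → C(ℝ, ℝ)) (t : ℝ) : ℝ :=
  Real.sqrt ((∑ i, (l i t) ^ 2) / n - (empMean n l t) ^ 2)

/-- The standardized (adaptive) multiplier bootstrap quantile `Q̂_α(l)`: the infimum of
all `z` such that
`P_ξ(sup_{t ∈ [t₁,t₂]} |n^{−1/2} Σ_i ξ_i (l_i(t) − l̄_n(t))/σ̂_n(t)| > z) ≤ α`,
the probability taken over i.i.d. standard Gaussian multipliers `ξ` only. -/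
def adaptQuant (t₁ t₂ α : ℝ) (n : ℕ) (l : Fin n → C(ℝ, ℝ)) : ℝ :=
  sInf {z : ℝ |
    (Measure.pi fun _ : Fin n => gaussianReal 0 1)
      {ξ | z < ⨆ t : Icc t₁ t₂,
          |(∑ i, ξ i * (l i ↑t - empMean n l ↑t) / empSD n l ↑t) / Real.sqrt n|}
      ≤ ENNReal.ofReal α}

/-- The first three derivatives of `Real.smoothTransition` are uniformly bounded. -/
lemma exists_bound_iteratedDeriv_smoothTransition :
    ∃ D > (0 : ℝ), ∀ k ∈ Finset.Icc 1 3, ∀ x,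
      |iteratedDeriv k Real.smoothTransition x| ≤ D := by
  have key : ∀ k : ℕ, 1 ≤ k → ∃ D : ℝ, ∀ x, |iteratedDeriv k Real.smoothTransition x| ≤ D := by
    intro k hk
    have hcont : Continuous (iteratedDeriv k Real.smoothTransition) :=
      (Real.smoothTransition.contDiff (n := ⊤)).continuous_iteratedDeriv k
        (by exact_mod_cast le_top)
    obtain ⟨D, hD⟩ := (isCompact_Icc (a := (0 : ℝ)) (b := 1)).exists_bound_of_continuousOn
      hcont.continuousOn
    refine ⟨max D 0, fun x => ?_⟩
    have hz : ∀ a : ℝ, Real.smoothTransition =ᶠ[nhds x] (fun _ => a) →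
        |iteratedDeriv k Real.smoothTransition x| ≤ max D 0 := by
      intro a ha
      rw [ha.iteratedDeriv_eq k, iteratedDeriv_const]
      simp [show k ≠ 0 by omega]
    rcases lt_or_ge x 0 with hx | hx
    · refine hz 0 ?_
      filter_upwards [Iio_mem_nhds hx] with y hy
      exact Real.smoothTransition.zero_of_nonpos (le_of_lt hy)
    rcases lt_or_ge 1 x with hx1 | hx1
    · refine hz 1 ?_
      filter_upwards [Ioi_mem_nhds hx1] with y hy
      exact Real.smoothTransition.one_of_one_le (le_of_lt hy)
    · exact (hD x ⟨hx, hx1⟩).trans (le_max_left _ _)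
  obtain ⟨D₁, h₁⟩ := key 1 le_rfl
  obtain ⟨D₂, h₂⟩ := key 2 (by norm_num)
  obtain ⟨D₃, h₃⟩ := key 3 (by norm_num)
  refine ⟨max 1 (max D₁ (max D₂ D₃)), by positivity, fun k hk x => ?_⟩
  have : k = 1 ∨ k = 2 ∨ k = 3 := by
    simp only [Finset.mem_Icc] at hk; omega
  rcases this with rfl | rfl | rfl
  · exact (h₁ x).trans (by simp)
  · exact (h₂ x).trans (by simp)
  · exact (h₃ x).trans (by simp)

lemma hasDerivAt_iteratedDeriv_smoothTransition (k : ℕ) (x : ℝ) :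
    HasDerivAt (iteratedDeriv k Real.smoothTransition)
      (iteratedDeriv (k + 1) Real.smoothTransition x) x := by
  rw [iteratedDeriv_succ]
  exact ((Real.smoothTransition.contDiff (n := ⊤)).differentiable_iteratedDeriv k
    (by exact_mod_cast WithTop.coe_lt_top _) x).hasDerivAt

/-- If `f 0 = 0` and `|f' t| ≤ A |t| ^ k`, then `|f s| ≤ A |s| ^ (k + 1)`. -/
lemma abs_le_pow_succ_of_deriv_le {f f' : ℝ → ℝ} (hf : ∀ t, HasDerivAt f (f' t) t) (h0 : f 0 = 0)
    {A : ℝ} (hA : 0 ≤ A) {k : ℕ} (hb : ∀ t, |f' t| ≤ A * |t| ^ k) (s : ℝ) :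
    |f s| ≤ A * |s| ^ (k + 1) := by
  have := (convex_Icc (-|s|) |s|).norm_image_sub_le_of_norm_hasDerivWithin_le
    (f := f) (f' := f') (C := A * |s| ^ k) (x := 0) (y := s)
    (fun x _ => (hf x).hasDerivWithinAt)
    (fun x hx => (hb x).trans (by
      have : |x| ≤ |s| := abs_le.2 hx
      gcongr))
    ⟨by simp, by simp⟩ ⟨neg_abs_le s, le_abs_self s⟩
  simpa [h0, pow_succ, mul_assoc] using this

/-- Second order Taylor expansion with a crude remainder. -/
lemma taylor_two {f f₁ f₂ : ℝ → ℝ} (h₁ : ∀ t, HasDerivAt f (f₁ t) t)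
    (h₂ : ∀ t, HasDerivAt f₁ (f₂ t) t) {A : ℝ} (hb : ∀ t, |f₂ t| ≤ A) (s : ℝ) :
    |f s - f 0 - s * f₁ 0| ≤ A * |s| ^ 2 := by
  have hA : 0 ≤ A := (abs_nonneg _).trans (hb 0)
  have e₁ : ∀ t, |f₁ t - f₁ 0| ≤ A * |t| ^ 1 :=
    abs_le_pow_succ_of_deriv_le (fun t => (h₂ t).sub_const _) (by simp) hA (k := 0)
      (by simpa using hb)
  refine abs_le_pow_succ_of_deriv_le (f := fun t => f t - f 0 - t * f₁ 0)
    (f' := fun t => f₁ t - f₁ 0) (fun t => ?_) (by simp) hA e₁ s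
  exact (((h₁ t).sub_const (f 0)).sub ((hasDerivAt_id t).mul_const (f₁ 0))).congr_deriv (by simp)

/-- Third order Taylor expansion with a crude remainder. -/
lemma taylor_three {f f₁ f₂ f₃ : ℝ → ℝ} (h₁ : ∀ t, HasDerivAt f (f₁ t) t)
    (h₂ : ∀ t, HasDerivAt f₁ (f₂ t) t) (h₃ : ∀ t, HasDerivAt f₂ (f₃ t) t)
    {A : ℝ} (hb : ∀ t, |f₃ t| ≤ A) (s : ℝ) :
    |f s - f 0 - s * f₁ 0 - s ^ 2 * (f₂ 0 / 2)| ≤ A * |s| ^ 3 := by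
  have hA : 0 ≤ A := (abs_nonneg _).trans (hb 0)
  refine abs_le_pow_succ_of_deriv_le (f := fun t => f t - f 0 - t * f₁ 0 - t ^ 2 * (f₂ 0 / 2))
    (f' := fun t => f₁ t - f₁ 0 - t * f₂ 0) (fun t => ?_) (by simp) hA
    (taylor_two h₂ h₃ hb) s
  have := (((h₁ t).sub_const (f 0)).sub ((hasDerivAt_id t).mul_const (f₁ 0))).sub
    ((hasDerivAt_pow 2 t).mul_const (f₂ 0 / 2))
  exact this.congr_deriv (by simp; ring)

section LogSumExp

variable {ι : Type*} [Fintype ι] (b c : ι → ℝ)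

/-- Gibbs moments `∑ cᵢᵏ exp (bᵢ + s cᵢ) / ∑ exp (bᵢ + s cᵢ)`. -/
def gibbsMoment (k : ℕ) (s : ℝ) : ℝ :=
  (∑ i, c i ^ k * Real.exp (b i + s * c i)) / ∑ i, Real.exp (b i + s * c i)

lemma hasDerivAt_sum_pow_mul_exp (k : ℕ) (s : ℝ) :
    HasDerivAt (fun s => ∑ i, c i ^ k * Real.exp (b i + s * c i))
      (∑ i, c i ^ (k + 1) * Real.exp (b i + s * c i)) s := by
  refine HasDerivAt.fun_sum fun i _ => ?_
  have := (((hasDerivAt_id s).mul_const (c i)).const_add (b i)).exp.const_mul (c i ^ k)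
  exact this.congr_deriv (by simp; ring)

variable [Nonempty ι]

lemma sum_exp_pos (v : ι → ℝ) : 0 < ∑ i, Real.exp (v i) :=
  Finset.sum_pos (fun _ _ => Real.exp_pos _) Finset.univ_nonempty

lemma abs_gibbsMoment_le {κ : ℝ} (hc : ∀ i, |c i| ≤ κ) (k : ℕ) (s : ℝ) :
    |gibbsMoment b c k s| ≤ κ ^ k := by
  have hU := sum_exp_pos fun i => b i + s * c i
  rw [gibbsMoment, abs_div, abs_of_pos hU, div_le_iff₀ hU, Finset.mul_sum]
  refine (Finset.abs_sum_le_sum_abs _ _).trans (Finset.sum_le_sum fun i _ => ?_)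
  rw [abs_mul, abs_pow, abs_of_pos (Real.exp_pos _)]
  gcongr
  exact hc i

lemma hasDerivAt_gibbsMoment (k : ℕ) (s : ℝ) :
    HasDerivAt (gibbsMoment b c k)
      (gibbsMoment b c (k + 1) s - gibbsMoment b c k s * gibbsMoment b c 1 s) s := by
  have hU := sum_exp_pos fun i => b i + s * c i
  have h0 := hasDerivAt_sum_pow_mul_exp b c 0 s
  simp only [pow_zero, one_mul, zero_add] at h0
  have := (hasDerivAt_sum_pow_mul_exp b c k s).div h0 hU.ne'
  refine this.congr_deriv ?_
  simp only [gibbsMoment]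
  field_simp

lemma hasDerivAt_log_sum_exp (s : ℝ) :
    HasDerivAt (fun s => Real.log (∑ i, Real.exp (b i + s * c i))) (gibbsMoment b c 1 s) s := by
  have hU := sum_exp_pos fun i => b i + s * c i
  have h0 := hasDerivAt_sum_pow_mul_exp b c 0 s
  simp only [pow_zero, one_mul, zero_add] at h0
  exact h0.log hU.ne'

variable {b c}

/-- Taylor expansions of `s ↦ G (log ∑ exp (bᵢ + s cᵢ))` at orders two and three, where the
remainders are controlled by the derivatives of `G` and by `κ = max |cᵢ|`. -/
lemma taylor_comp_log_sum_exp {G G₁ G₂ G₃ : ℝ → ℝ} (h₁ : ∀ t, HasDerivAt G (G₁ t) t)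
    (h₂ : ∀ t, HasDerivAt G₁ (G₂ t) t) (h₃ : ∀ t, HasDerivAt G₂ (G₃ t) t) {D κ : ℝ}
    (hb₁ : ∀ t, |G₁ t| ≤ D) (hb₂ : ∀ t, |G₂ t| ≤ D) (hb₃ : ∀ t, |G₃ t| ≤ D)
    (hc : ∀ i, |c i| ≤ κ) :
    ∃ Q : ℝ, ∀ s,
      |G (Real.log (∑ i, Real.exp (b i + s * c i))) - G (Real.log (∑ i, Real.exp (b i)))
        - s * (G₁ (Real.log (∑ i, Real.exp (b i))) * gibbsMoment b c 1 0)| ≤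
          3 * D * κ ^ 2 * |s| ^ 2 ∧
      |G (Real.log (∑ i, Real.exp (b i + s * c i))) - G (Real.log (∑ i, Real.exp (b i)))
        - s * (G₁ (Real.log (∑ i, Real.exp (b i))) * gibbsMoment b c 1 0) - s ^ 2 * Q| ≤
          13 * D * κ ^ 3 * |s| ^ 3 := by
  set u : ℝ → ℝ := fun s => Real.log (∑ i, Real.exp (b i + s * c i)) with hu
  set m : ℕ → ℝ → ℝ := gibbsMoment b c
  have hκ : 0 ≤ κ := (abs_nonneg _).trans (hc (Classical.arbitrary ι))
  have hD : 0 ≤ D := (abs_nonneg _).trans (hb₁ 0)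
  have du : ∀ s, HasDerivAt u (m 1 s) s := hasDerivAt_log_sum_exp b c
  have dm : ∀ k s, HasDerivAt (m k) (m (k + 1) s - m k s * m 1 s) s := hasDerivAt_gibbsMoment b c
  have bm : ∀ k s, |m k s| ≤ κ ^ k := abs_gibbsMoment_le b c hc
  have d₁ : ∀ s, HasDerivAt (fun s => G (u s)) (G₁ (u s) * m 1 s) s := fun s =>
    (h₁ (u s)).comp s (du s)
  have d₂ : ∀ s, HasDerivAt (fun s => G₁ (u s) * m 1 s)
      (G₂ (u s) * m 1 s ^ 2 + G₁ (u s) * (m 2 s - m 1 s ^ 2)) s := fun s => by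
    refine (((h₂ (u s)).comp s (du s)).mul (dm 1 s)).congr_deriv ?_
    simp only [Function.comp_apply]; ring
  have d₃ : ∀ s, HasDerivAt (fun s => G₂ (u s) * m 1 s ^ 2 + G₁ (u s) * (m 2 s - m 1 s ^ 2))
      (G₃ (u s) * m 1 s ^ 3 + 3 * (G₂ (u s) * (m 1 s * (m 2 s - m 1 s ^ 2)))
        + G₁ (u s) * (m 3 s - 3 * (m 1 s * m 2 s) + 2 * m 1 s ^ 3)) s := fun s => by
    refine ((((h₃ (u s)).comp s (du s)).mul ((dm 1 s).pow 2)).add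
      (((h₂ (u s)).comp s (du s)).mul ((dm 2 s).sub ((dm 1 s).pow 2)))).congr_deriv ?_
    simp only [Function.comp_apply, Pi.pow_apply, Pi.sub_apply]; push_cast; ring
  have b1 : ∀ s, |m 1 s| ≤ κ := fun s => by simpa using bm 1 s
  have b2 : ∀ s, |m 2 s - m 1 s ^ 2| ≤ 2 * κ ^ 2 := fun s => by
    have := abs_sub (m 2 s) (m 1 s ^ 2)
    have h2 : |m 1 s ^ 2| ≤ κ ^ 2 := by rw [abs_pow]; gcongr; exact b1 s
    linarith [bm 2 s]
  have b3 : ∀ s, |m 3 s - 3 * (m 1 s * m 2 s) + 2 * m 1 s ^ 3| ≤ 6 * κ ^ 3 := fun s => by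
    have e1 : |m 1 s * m 2 s| ≤ κ * κ ^ 2 := by
      rw [abs_mul]; gcongr; exacts [b1 s, bm 2 s]
    have e2 : |m 1 s ^ 3| ≤ κ ^ 3 := by rw [abs_pow]; gcongr; exact b1 s
    have e3 := bm 3 s
    rw [abs_le] at *
    constructor <;> nlinarith
  have q2 : ∀ s, |G₂ (u s) * m 1 s ^ 2 + G₁ (u s) * (m 2 s - m 1 s ^ 2)| ≤ 3 * D * κ ^ 2 := by
    intro s
    have e1 : |G₂ (u s) * m 1 s ^ 2| ≤ D * κ ^ 2 := by
      rw [abs_mul, abs_pow]; gcongr; exacts [hb₂ _, b1 s]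
    have e2 : |G₁ (u s) * (m 2 s - m 1 s ^ 2)| ≤ D * (2 * κ ^ 2) := by
      rw [abs_mul]; gcongr; exacts [hb₁ _, b2 s]
    linarith [abs_add_le (G₂ (u s) * m 1 s ^ 2) (G₁ (u s) * (m 2 s - m 1 s ^ 2))]
  have q3 : ∀ s, |G₃ (u s) * m 1 s ^ 3 + 3 * (G₂ (u s) * (m 1 s * (m 2 s - m 1 s ^ 2)))
        + G₁ (u s) * (m 3 s - 3 * (m 1 s * m 2 s) + 2 * m 1 s ^ 3)| ≤ 13 * D * κ ^ 3 := by
    intro s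
    have e1 : |G₃ (u s) * m 1 s ^ 3| ≤ D * κ ^ 3 := by
      rw [abs_mul, abs_pow]; gcongr; exacts [hb₃ _, b1 s]
    have e2 : |G₂ (u s) * (m 1 s * (m 2 s - m 1 s ^ 2))| ≤ D * (κ * (2 * κ ^ 2)) := by
      rw [abs_mul, abs_mul]; gcongr; exacts [hb₂ _, b1 s, b2 s]
    have e3 : |G₁ (u s) * (m 3 s - 3 * (m 1 s * m 2 s) + 2 * m 1 s ^ 3)| ≤ D * (6 * κ ^ 3) := by
      rw [abs_mul]; gcongr; exacts [hb₁ _, b3 s]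
    rw [abs_le] at *
    constructor <;> nlinarith
  refine ⟨(G₂ (u 0) * m 1 0 ^ 2 + G₁ (u 0) * (m 2 0 - m 1 0 ^ 2)) / 2, fun s => ⟨?_, ?_⟩⟩
  · simpa [hu] using taylor_two d₁ d₂ q2 s
  · simpa [hu] using taylor_three d₁ d₂ d₃ q3 s

end LogSumExp

/-- A common bound on the first three derivatives of `Real.smoothTransition`. -/
def smoothBound : ℝ := exists_bound_iteratedDeriv_smoothTransition.choose

lemma smoothBound_pos : 0 < smoothBound :=
  exists_bound_iteratedDeriv_smoothTransition.choose_spec.1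

lemma abs_integral_le_of_abs_le {Ω : Type*} [MeasurableSpace Ω] {μ : Measure Ω} {f g : Ω → ℝ}
    (hg : Integrable g μ) (h : ∀ ω, |f ω| ≤ g ω) : |∫ ω, f ω ∂μ| ≤ ∫ ω, g ω ∂μ :=
  norm_integral_le_of_norm_le (f := f) hg (ae_of_all _ h)

section SmoothExceed

variable {J : Type*} [Fintype J]

/-- The logarithm of twice the cardinality of the index set. -/
def logCard (J : Type*) [Fintype J] : ℝ := Real.log (2 * Fintype.card J)

/-- The log-sum-exp approximation of `β * ‖w‖` for the sup norm. -/
def logSumExpAbs (β : ℝ) (w : J → ℝ) : ℝ :=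
  Real.log (∑ k : J × Bool, Real.exp (cond k.2 (β * w k.1) (-(β * w k.1))))

/-- A smooth version of the indicator of `{w | z < ‖w‖}` with smoothing scale `ε`. -/
def smoothExceed (ε z : ℝ) (w : J → ℝ) : ℝ :=
  Real.smoothTransition ((logSumExpAbs (logCard J / ε) w - logCard J / ε * z) / logCard J)

lemma smoothExceed_nonneg (ε z : ℝ) (w : J → ℝ) : 0 ≤ smoothExceed ε z w :=
  Real.smoothTransition.nonneg _

lemma smoothExceed_le_one (ε z : ℝ) (w : J → ℝ) : smoothExceed ε z w ≤ 1 :=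
  Real.smoothTransition.le_one _

lemma abs_smoothExceed_le_one (ε z : ℝ) (w : J → ℝ) : |smoothExceed ε z w| ≤ 1 := by
  rw [abs_of_nonneg (smoothExceed_nonneg ε z w)]
  exact smoothExceed_le_one ε z w

variable [Nonempty J]

lemma continuous_smoothExceed (ε z : ℝ) : Continuous (smoothExceed ε z : (J → ℝ) → ℝ) := by
  unfold smoothExceed logSumExpAbs
  refine Real.smoothTransition.continuous.comp ?_
  refine Continuous.div_const (Continuous.sub (Continuous.log ?_ ?_) continuous_const) _
  · refine continuous_finsetSum _ fun k _ => ?_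
    rcases k with ⟨j, _ | _⟩ <;> dsimp only [_root_.cond] <;> fun_prop
  · exact fun w => (sum_exp_pos _).ne'

lemma mul_norm_le_logSumExpAbs (β : ℝ) (w : J → ℝ) :
    β * ‖w‖ ≤ logSumExpAbs β w := by
  obtain ⟨j, hj⟩ : ∃ j, ‖w‖ = ‖w j‖ := by
    obtain ⟨j, hj⟩ := Finite.exists_max fun j => ‖w j‖
    exact ⟨j, le_antisymm ((pi_norm_le_iff_of_nonneg (norm_nonneg _)).2 hj) (norm_le_pi_norm w j)⟩
  rw [logSumExpAbs, Real.le_log_iff_exp_le (sum_exp_pos _), hj, Real.norm_eq_abs]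
  have hs : ∀ k : J × Bool, Real.exp (cond k.2 (β * w k.1) (-(β * w k.1))) ≤
      ∑ k : J × Bool, Real.exp (cond k.2 (β * w k.1) (-(β * w k.1))) := fun k =>
    Finset.single_le_sum (f := fun k : J × Bool =>
      Real.exp (cond k.2 (β * w k.1) (-(β * w k.1)))) (fun _ _ => (Real.exp_pos _).le)
      (Finset.mem_univ k)
  rcases abs_cases (w j) with ⟨h, _⟩ | ⟨h, _⟩ <;> rw [h]
  · exact hs (j, true)
  · simpa using hs (j, false)

lemma logSumExpAbs_le {β : ℝ} (hβ : 0 ≤ β) (w : J → ℝ) :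
    logSumExpAbs β w ≤ β * ‖w‖ + logCard J := by
  have hcard : (0 : ℝ) < 2 * Fintype.card J := by
    have : 0 < Fintype.card J := Fintype.card_pos
    positivity
  rw [logSumExpAbs, Real.log_le_iff_le_exp (sum_exp_pos _), Real.exp_add, logCard,
    Real.exp_log hcard]
  have : ∀ k : J × Bool, Real.exp (cond k.2 (β * w k.1) (-(β * w k.1))) ≤
      Real.exp (β * ‖w‖) := by
    rintro ⟨j, s⟩
    have h1 : |w j| ≤ ‖w‖ := norm_le_pi_norm w j
    rw [Real.exp_le_exp]
    cases s
    · rw [cond_false, ← mul_neg]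
      gcongr
      exact (neg_le_abs _).trans h1
    · rw [cond_true]
      gcongr
      exact (le_abs_self _).trans h1
  refine (Finset.sum_le_card_nsmul _ _ _ fun k _ => this k).trans (le_of_eq ?_)
  simp [Finset.card_univ, Fintype.card_prod]
  ring

lemma smoothExceed_eq_one {ε z : ℝ} (hℓ : 1 ≤ logCard J) (hε : 0 < ε) {w : J → ℝ}
    (h : z + ε ≤ ‖w‖) : smoothExceed ε z w = 1 := by
  have hβ : 0 < logCard J / ε := by positivity
  refine Real.smoothTransition.one_of_one_le ?_
  rw [le_div_iff₀ (by positivity), one_mul]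
  have h1 := mul_norm_le_logSumExpAbs (logCard J / ε) w
  have h2 : logCard J / ε * (z + ε) ≤ logCard J / ε * ‖w‖ := by gcongr
  have h3 : logCard J / ε * ε = logCard J := by field_simp
  linarith

lemma smoothExceed_eq_zero {ε z : ℝ} (hℓ : 1 ≤ logCard J) (hε : 0 < ε) {w : J → ℝ}
    (h : ‖w‖ ≤ z - ε) : smoothExceed ε z w = 0 := by
  have hβ : 0 < logCard J / ε := by positivity
  refine Real.smoothTransition.zero_of_nonpos (div_nonpos_of_nonpos_of_nonneg ?_ (by positivity))
  have h1 := logSumExpAbs_le hβ.le w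
  have h2 : logCard J / ε * ‖w‖ ≤ logCard J / ε * (z - ε) := by gcongr
  have h3 : logCard J / ε * ε = logCard J := by field_simp
  linarith

lemma smoothExceed_taylor {ε B : ℝ} (z : ℝ) (hℓ : 1 ≤ logCard J) (hε : 0 < ε) (w : J → ℝ) :
    ∃ A : J → ℝ, ∀ x : J → ℝ, (∀ j, |x j| ≤ B) → ∃ Q : ℝ, ∀ s : ℝ,
      |smoothExceed ε z (w + s • x) - smoothExceed ε z w - s * ∑ j, A j * x j| ≤
        3 * (smoothBound / logCard J) * (logCard J / ε * B) ^ 2 * |s| ^ 2 ∧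
      |smoothExceed ε z (w + s • x) - smoothExceed ε z w - s * ∑ j, A j * x j - s ^ 2 * Q| ≤
        13 * (smoothBound / logCard J) * (logCard J / ε * B) ^ 3 * |s| ^ 3 := by
  set ℓ := logCard J with hℓdef
  set β := ℓ / ε with hβdef
  have hℓ0 : 0 < ℓ := by linarith
  have hβ : 0 < β := by positivity
  set g : ℕ → ℝ → ℝ := fun k => iteratedDeriv k Real.smoothTransition with hg
  have dg : ∀ k x, HasDerivAt (g k) (g (k + 1) x) x := hasDerivAt_iteratedDeriv_smoothTransition
  have bg : ∀ k ∈ Finset.Icc 1 3, ∀ x, |g k x| ≤ smoothBound :=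
    exists_bound_iteratedDeriv_smoothTransition.choose_spec.2
  set G : ℕ → ℝ → ℝ := fun k v => g k ((v - β * z) / ℓ) / ℓ ^ k with hG
  have dG : ∀ k x, HasDerivAt (G k) (G (k + 1) x) x := fun k x => by
    have h1 : HasDerivAt (fun v => (v - β * z) / ℓ) (1 / ℓ) x :=
      ((hasDerivAt_id x).sub_const _).div_const _
    refine (((dg k _).comp x h1).div_const (ℓ ^ k)).congr_deriv ?_
    simp only [hG, pow_succ]
    field_simp
  have bG : ∀ k ∈ Finset.Icc 1 3, ∀ x, |G k x| ≤ smoothBound / ℓ := fun k hk x => by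
    have h1 := bg k hk ((x - β * z) / ℓ)
    simp only [hG]
    rw [abs_div, abs_of_pos (pow_pos hℓ0 k)]
    have : ℓ ≤ ℓ ^ k := le_self_pow₀ hℓ (by simp only [Finset.mem_Icc] at hk; omega)
    have := smoothBound_pos
    gcongr
  set b : J × Bool → ℝ := fun k => cond k.2 (β * w k.1) (-(β * w k.1)) with hb
  refine ⟨fun j => G 1 (Real.log (∑ k, Real.exp (b k))) *
    (β * (Real.exp (β * w j) - Real.exp (-(β * w j))) / ∑ k, Real.exp (b k)), fun x hx => ?_⟩
  set c : J × Bool → ℝ := fun k => cond k.2 (β * x k.1) (-(β * x k.1)) with hc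
  have bc : ∀ k, |c k| ≤ β * B := by
    rintro ⟨j, s⟩
    have : |β * x j| ≤ β * B := by
      rw [abs_mul, abs_of_pos hβ]
      gcongr
      exact hx j
    cases s <;> simpa [hc] using this
  obtain ⟨Q, hQ⟩ := taylor_comp_log_sum_exp (b := b) (dG 0) (dG 1) (dG 2)
    (bG 1 (by simp)) (bG 2 (by simp)) (bG 3 (by simp)) bc
  refine ⟨Q, fun s => ?_⟩
  have e0 : ∀ s : ℝ, smoothExceed ε z (w + s • x) =
      G 0 (Real.log (∑ k, Real.exp (b k + s * c k))) := fun s => by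
    simp only [smoothExceed, logSumExpAbs, hG, hg, iteratedDeriv_zero, pow_zero, div_one]
    rw [← hℓdef, ← hβdef]
    congr 4
    refine Finset.sum_congr rfl fun k _ => ?_
    rcases k with ⟨j, _ | _⟩ <;> simp [hb, hc] <;> ring
  have e1 : smoothExceed ε z w = G 0 (Real.log (∑ k, Real.exp (b k))) := by
    simpa using e0 0
  have e2 : ∑ j, G 1 (Real.log (∑ k, Real.exp (b k))) *
      (β * (Real.exp (β * w j) - Real.exp (-(β * w j))) / ∑ k, Real.exp (b k)) * x j =
      G 1 (Real.log (∑ k, Real.exp (b k))) * gibbsMoment b c 1 0 := by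
    rw [gibbsMoment, Fintype.sum_prod_type (fun k : J × Bool => c k ^ 1 * _)]
    simp only [zero_mul, add_zero, pow_one, Fintype.sum_bool, mul_div_assoc', Finset.mul_sum,
      Finset.sum_div]
    refine Finset.sum_congr rfl fun j _ => ?_
    simp only [hb, hc, cond_true, cond_false]
    ring
  rw [e0 s, e1, e2]
  exact hQ s

/-- The third absolute moment of the standard Gaussian. -/
def gaussAbsMomentThree : ℝ := ∫ x, |x| ^ 3 ∂(gaussianReal 0 1)

lemma integrable_abs_pow_gaussianReal (k : ℕ) :
    Integrable (fun x : ℝ => |x| ^ k) (gaussianReal 0 1) := by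
  simpa using (memLp_id_gaussianReal (μ := 0) (v := 1) k).integrable_norm_pow'

lemma gaussAbsMomentThree_nonneg : 0 ≤ gaussAbsMomentThree :=
  integral_nonneg fun _ => by positivity

lemma integral_sq_gaussianReal : ∫ x, x ^ 2 ∂(gaussianReal 0 1) = 1 := by
  have h := variance_fun_id_gaussianReal (μ := 0) (v := 1)
  rw [variance_of_integral_eq_zero (by fun_prop) (by simp)] at h
  simpa using h

lemma integrable_smoothExceed_comp {Ω : Type*} [MeasurableSpace Ω] {μ : Measure Ω}
    [IsFiniteMeasure μ] (ε z : ℝ) {f : Ω → J → ℝ} (hf : Measurable f) :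
    Integrable (fun ω => smoothExceed ε z (f ω)) μ :=
  Integrable.of_bound (((continuous_smoothExceed ε z).measurable.comp hf).aestronglyMeasurable) 1
    (ae_of_all _ fun ω => abs_smoothExceed_le_one ε z (f ω))

/-- Randomizing the sign and size of a direction by a Gaussian does not change the mean of
`smoothExceed` up to second order. -/
lemma abs_integral_smoothExceed_sub_le {ε B : ℝ} (z : ℝ) (hℓ : 1 ≤ logCard J) (hε : 0 < ε)
    (w : J → ℝ) {x : J → ℝ} (hx : ∀ j, |x j| ≤ B) (h : ℝ) :
    |∫ ξ, smoothExceed ε z (w + (ξ * h) • x) ∂(gaussianReal 0 1) - smoothExceed ε z w| ≤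
      3 * (smoothBound / logCard J) * (logCard J / ε * B) ^ 2 * h ^ 2 := by
  obtain ⟨A, hA⟩ := smoothExceed_taylor (B := B) z hℓ hε w
  obtain ⟨Q, hQ⟩ := hA x hx
  have i1 : Integrable (fun ξ : ℝ => smoothExceed ε z (w + (ξ * h) • x)) (gaussianReal 0 1) :=
    integrable_smoothExceed_comp ε z (by fun_prop)
  have i2 : Integrable (fun ξ : ℝ => ξ) (gaussianReal 0 1) :=
    (memLp_id_gaussianReal 1).integrable le_rfl
  have i3 : Integrable (fun ξ : ℝ => |ξ| ^ 2) (gaussianReal 0 1) :=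
    integrable_abs_pow_gaussianReal 2
  have i12 : Integrable (fun ξ : ℝ => smoothExceed ε z (w + (ξ * h) • x) - smoothExceed ε z w)
      (gaussianReal 0 1) := i1.sub (integrable_const _)
  have key : ∫ ξ, smoothExceed ε z (w + (ξ * h) • x) ∂(gaussianReal 0 1) - smoothExceed ε z w =
      ∫ ξ, (smoothExceed ε z (w + (ξ * h) • x) - smoothExceed ε z w
        - ξ * (h * ∑ j, A j * x j)) ∂(gaussianReal 0 1) := by
    rw [integral_sub i12 (i2.mul_const _),
      integral_sub i1 (integrable_const _), integral_mul_const, integral_id_gaussianReal]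
    simp
  rw [key]
  refine (abs_integral_le_of_abs_le (i3.mul_const
      (3 * (smoothBound / logCard J) * (logCard J / ε * B) ^ 2 * h ^ 2))
    (fun ξ => ?_)).trans (le_of_eq ?_)
  · have := (hQ (ξ * h)).1
    rw [abs_mul ξ h, mul_pow |ξ|, sq_abs h, mul_assoc ξ] at this
    linarith
  · rw [integral_mul_const]
    simp [integral_sq_gaussianReal]

/-- Comparison of one deterministic step with its Gaussian randomization, up to third order. -/
lemma abs_smoothExceed_sub_integral_le {ε B : ℝ} (z : ℝ) (hℓ : 1 ≤ logCard J) (hε : 0 < ε)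
    (w : J → ℝ) : ∃ A : J → ℝ, ∀ x : J → ℝ, (∀ j, |x j| ≤ B) → ∀ h : ℝ, 0 ≤ h →
    |smoothExceed ε z (w + h • x) - ∫ ξ, smoothExceed ε z (w + (ξ * h) • x) ∂(gaussianReal 0 1)
        - ∑ j, A j * x j * h| ≤
      13 * (smoothBound / logCard J) * (logCard J / ε * B) ^ 3 * h ^ 3 *
        (1 + gaussAbsMomentThree) := by
  obtain ⟨A, hA⟩ := smoothExceed_taylor (B := B) z hℓ hε w
  refine ⟨A, fun x hx h hh => ?_⟩
  obtain ⟨Q, hQ⟩ := hA x hx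
  set R := 13 * (smoothBound / logCard J) * (logCard J / ε * B) ^ 3 with hR
  have i1 : Integrable (fun ξ : ℝ => smoothExceed ε z (w + (ξ * h) • x)) (gaussianReal 0 1) :=
    integrable_smoothExceed_comp ε z (by fun_prop)
  have i2 : Integrable (fun ξ : ℝ => ξ) (gaussianReal 0 1) :=
    (memLp_id_gaussianReal 1).integrable le_rfl
  have i3 : Integrable (fun ξ : ℝ => ξ ^ 2) (gaussianReal 0 1) := by
    simpa using integrable_abs_pow_gaussianReal 2
  have i4 := integrable_abs_pow_gaussianReal 3
  have i12 : Integrable (fun ξ : ℝ => smoothExceed ε z (w + (ξ * h) • x) - smoothExceed ε z w)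
      (gaussianReal 0 1) := i1.sub (integrable_const _)
  have i123 : Integrable (fun ξ : ℝ => smoothExceed ε z (w + (ξ * h) • x) - smoothExceed ε z w
      - ξ * (h * ∑ j, A j * x j)) (gaussianReal 0 1) := i12.sub (i2.mul_const _)
  have key : ∫ ξ, smoothExceed ε z (w + (ξ * h) • x) ∂(gaussianReal 0 1) - smoothExceed ε z w
        - h ^ 2 * Q =
      ∫ ξ, (smoothExceed ε z (w + (ξ * h) • x) - smoothExceed ε z w
        - ξ * (h * ∑ j, A j * x j) - ξ ^ 2 * (h ^ 2 * Q)) ∂(gaussianReal 0 1) := by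
    rw [integral_sub i123 (i3.mul_const _),
      integral_sub i12 (i2.mul_const _),
      integral_sub i1 (integrable_const _), integral_mul_const, integral_mul_const,
      integral_id_gaussianReal, integral_sq_gaussianReal]
    simp
  have b1 : |∫ ξ, smoothExceed ε z (w + (ξ * h) • x) ∂(gaussianReal 0 1) - smoothExceed ε z w
        - h ^ 2 * Q| ≤ R * h ^ 3 * gaussAbsMomentThree := by
    rw [key]
    refine (abs_integral_le_of_abs_le (i4.const_mul (R * h ^ 3))
      (fun ξ => ?_)).trans (le_of_eq ?_)
    · have := (hQ (ξ * h)).2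
      rw [abs_mul ξ h, mul_pow |ξ|, abs_of_nonneg hh, mul_pow ξ, mul_assoc ξ, mul_assoc (ξ ^ 2)] at this
      linarith
    · rw [integral_const_mul, gaussAbsMomentThree]
  have b2 := (hQ h).2
  rw [abs_of_nonneg hh] at b2
  have e : ∑ j, A j * x j * h = h * ∑ j, A j * x j := by
    rw [Finset.mul_sum]; exact Finset.sum_congr rfl fun j _ => by ring
  rw [e]
  rw [abs_le] at *
  constructor <;> linarith

end SmoothExceed

section ProductMeasure

variable {A B : Type*} [MeasurableSpace A] [MeasurableSpace B]

lemma integrable_of_measurable_of_abs_le {μ : Measure A} [IsFiniteMeasure μ] {F : A → ℝ} {K : ℝ}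
    (hF : Measurable F) (hK : ∀ a, |F a| ≤ K) : Integrable F μ :=
  Integrable.of_bound hF.aestronglyMeasurable K (ae_of_all _ hK)

lemma abs_integral_le_const {μ : Measure A} [IsProbabilityMeasure μ] {F : A → ℝ} {K : ℝ}
    (hK : ∀ a, |F a| ≤ K) : |∫ a, F a ∂μ| ≤ K :=
  (abs_integral_le_of_abs_le (integrable_const K) hK).trans_eq (by simp)

lemma measurable_finCons {n : ℕ} :
    Measurable (fun p : A × (Fin n → A) ↦ (Fin.cons p.1 p.2 : Fin (n + 1) → A)) := by
  refine measurable_pi_lambda _ fun i ↦ ?_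
  refine Fin.cases ?_ (fun j ↦ ?_) i
  · simpa using measurable_fst
  · simpa [Function.comp_def] using (measurable_pi_apply j).comp measurable_snd

lemma measurable_integral_right {μ : Measure B} [SFinite μ] {F : A × B → ℝ} (hF : Measurable F) :
    Measurable fun a ↦ ∫ b, F (a, b) ∂μ :=
  (hF.stronglyMeasurable.integral_prod_right').measurable

lemma integral_pi_succ {n : ℕ} (μ : Measure A) [IsProbabilityMeasure μ]
    {F : (Fin (n + 1) → A) → ℝ} :
    ∫ l, F l ∂(Measure.pi fun _ : Fin (n + 1) ↦ μ) =
      ∫ p, F (Fin.cons p.1 p.2) ∂(μ.prod (Measure.pi fun _ : Fin n ↦ μ)) := by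
  have h := (measurePreserving_piFinSuccAbove (fun _ : Fin (n + 1) ↦ μ) 0).symm.integral_comp' F
  rw [← h]
  refine integral_congr_ae (ae_of_all _ fun p ↦ ?_)
  simp [MeasurableEquiv.piFinSuccAbove, Fin.consEquiv]

/-- Replacing the summands of an i.i.d. sum one after the other. -/
lemma abs_integral_sum_pi_sub_le {V : Type*} [AddCommMonoid V] [MeasurableSpace V]
    [MeasurableAdd₂ V] {μ : Measure A} {ν : Measure B} [IsProbabilityMeasure μ]
    [IsProbabilityMeasure ν] {f : A → V} {g : B → V} (hf : Measurable f) (hg : Measurable g)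
    {Θ : V → ℝ} (hΘ : Measurable Θ) (hΘ1 : ∀ v, |Θ v| ≤ 1) {δ : ℝ}
    (hδ : ∀ w, |∫ a, Θ (w + f a) ∂μ - ∫ b, Θ (w + g b) ∂ν| ≤ δ) (n : ℕ) (w : V) :
    |∫ l, Θ (w + ∑ i, f (l i)) ∂(Measure.pi fun _ : Fin n ↦ μ)
      - ∫ l, Θ (w + ∑ i, g (l i)) ∂(Measure.pi fun _ : Fin n ↦ ν)| ≤ n * δ := by
  induction n generalizing w with
  | zero => simp
  | succ n ih =>
    have hmf : Measurable fun l : Fin n → A ↦ ∑ i, f (l i) :=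
      Finset.measurable_sum _ fun i _ ↦ hf.comp (measurable_pi_apply i)
    have hmg : Measurable fun l : Fin n → B ↦ ∑ i, g (l i) :=
      Finset.measurable_sum _ fun i _ ↦ hg.comp (measurable_pi_apply i)
    have hI1 : Measurable fun p : A × (Fin n → A) ↦ Θ (w + f p.1 + ∑ i, f (p.2 i)) :=
      hΘ.comp (((hf.comp measurable_fst).const_add w).add (hmf.comp measurable_snd))
    have hI2 : Measurable fun p : A × (Fin n → B) ↦ Θ (w + f p.1 + ∑ i, g (p.2 i)) :=
      hΘ.comp (((hf.comp measurable_fst).const_add w).add (hmg.comp measurable_snd))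
    have hI3 : Measurable fun p : B × (Fin n → B) ↦ Θ (w + g p.1 + ∑ i, g (p.2 i)) :=
      hΘ.comp (((hg.comp measurable_fst).const_add w).add (hmg.comp measurable_snd))
    rw [integral_pi_succ, integral_pi_succ]
    simp only [Fin.sum_univ_succ, Fin.cons_zero, Fin.cons_succ, ← add_assoc]
    have e1 : |∫ p, Θ (w + f p.1 + ∑ i, f (p.2 i)) ∂(μ.prod (Measure.pi fun _ : Fin n ↦ μ))
        - ∫ p, Θ (w + f p.1 + ∑ i, g (p.2 i)) ∂(μ.prod (Measure.pi fun _ : Fin n ↦ ν))|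
        ≤ n * δ := by
      rw [integral_prod _ (integrable_of_measurable_of_abs_le hI1 fun _ ↦ hΘ1 _),
        integral_prod _ (integrable_of_measurable_of_abs_le hI2 fun _ ↦ hΘ1 _), ← integral_sub]
      · exact abs_integral_le_const fun a ↦ ih (w + f a)
      · exact integrable_of_measurable_of_abs_le (measurable_integral_right hI1)
          fun a ↦ abs_integral_le_const fun _ ↦ hΘ1 _
      · exact integrable_of_measurable_of_abs_le (measurable_integral_right hI2)
          fun a ↦ abs_integral_le_const fun _ ↦ hΘ1 _
    have e2 : |∫ p, Θ (w + f p.1 + ∑ i, g (p.2 i)) ∂(μ.prod (Measure.pi fun _ : Fin n ↦ ν))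
        - ∫ p, Θ (w + g p.1 + ∑ i, g (p.2 i)) ∂(ν.prod (Measure.pi fun _ : Fin n ↦ ν))|
        ≤ δ := by
      rw [integral_prod_symm _ (integrable_of_measurable_of_abs_le hI2 fun _ ↦ hΘ1 _),
        integral_prod_symm _ (integrable_of_measurable_of_abs_le hI3 fun _ ↦ hΘ1 _),
        ← integral_sub]
      · refine abs_integral_le_const fun b ↦ ?_
        simpa only [add_right_comm] using hδ (w + ∑ i, g (b i))
      · exact integrable_of_measurable_of_abs_le
          (measurable_integral_right (hI2.comp measurable_swap))
          fun a ↦ abs_integral_le_const fun _ ↦ hΘ1 _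
      · exact integrable_of_measurable_of_abs_le
          (measurable_integral_right (hI3.comp measurable_swap))
          fun a ↦ abs_integral_le_const fun _ ↦ hΘ1 _
    push_cast
    have := abs_le.1 e1
    have := abs_le.1 e2
    rw [abs_le]
    constructor <;> linarith

/-- The Efron–Stein inequality for functions with bounded differences. -/
lemma integral_sq_pi_le_of_bounded_diff {μ : Measure A} [IsProbabilityMeasure μ] {c : ℝ} (n : ℕ)
    {Φ : (Fin n → A) → ℝ} (hΦ : Measurable Φ) {K : ℝ} (hK : ∀ l, |Φ l| ≤ K)
    (hc : ∀ l i a, |Φ (Function.update l i a) - Φ l| ≤ c) :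
    ∫ l, Φ l ^ 2 ∂(Measure.pi fun _ : Fin n ↦ μ)
      ≤ (∫ l, Φ l ∂(Measure.pi fun _ : Fin n ↦ μ)) ^ 2 + n * c ^ 2 := by
  induction n with
  | zero =>
    have e : Φ = fun _ ↦ Φ default := funext fun l ↦ congrArg Φ (Subsingleton.elim _ _)
    rw [e]
    simp
  | succ n ih =>
    have hm : Measurable fun p : A × (Fin n → A) ↦ Φ (Fin.cons p.1 p.2) :=
      hΦ.comp measurable_finCons
    have hm' : Measurable fun p : (Fin n → A) × A ↦ Φ (Fin.cons p.2 p.1) :=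
      hm.comp measurable_swap
    have hsq : ∀ l, |Φ l ^ 2| ≤ K ^ 2 := fun l ↦ by
      rw [abs_pow]; exact pow_le_pow_left₀ (abs_nonneg _) (hK l) 2
    let Ψ : (Fin n → A) → ℝ := fun l ↦ ∫ a, Φ (Fin.cons a l) ∂μ
    have hΨm : Measurable Ψ := measurable_integral_right hm'
    have hΨK : ∀ l, |Ψ l| ≤ K := fun l ↦ abs_integral_le_const fun _ ↦ hK _
    have hintegrable : ∀ l : Fin n → A, Integrable (fun a ↦ Φ (Fin.cons a l)) μ := fun l ↦
      integrable_of_measurable_of_abs_le (hm.comp measurable_prodMk_right) fun _ ↦ hK _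
    have hint2 : ∀ l : Fin n → A, Integrable (fun a ↦ Φ (Fin.cons a l) ^ 2) μ := fun l ↦
      integrable_of_measurable_of_abs_le ((hm.comp measurable_prodMk_right).pow_const 2)
        fun _ ↦ hsq _
    have hΨc : ∀ l i a, |Ψ (Function.update l i a) - Ψ l| ≤ c := fun l i a ↦ by
      simp only [Ψ]
      rw [← integral_sub (hintegrable _) (hintegrable _)]
      refine abs_integral_le_const fun b ↦ ?_
      have := hc (Fin.cons b l) i.succ a
      rwa [← Fin.cons_update] at this
    have h1 := ih hΨm hΨK hΨc
    have hstep : ∀ l : Fin n → A, ∫ a, Φ (Fin.cons a l) ^ 2 ∂μ ≤ Ψ l ^ 2 + c ^ 2 := fun l ↦ by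
      have hd : ∀ a, |Φ (Fin.cons a l) - Ψ l| ≤ c := fun a ↦ by
        have e : Φ (Fin.cons a l) - Ψ l
            = ∫ b, (Φ (Fin.cons a l) - Φ (Fin.cons b l)) ∂μ := by
          rw [integral_sub (integrable_const _) (hintegrable l)]; simp [Ψ]
        rw [e]
        refine abs_integral_le_const fun b ↦ ?_
        have := hc (Fin.cons b l) 0 a
        rwa [Fin.update_cons_zero] at this
      have h2 : ∫ a, (Φ (Fin.cons a l) ^ 2 - 2 * Ψ l * Φ (Fin.cons a l) + Ψ l ^ 2) ∂μ
          ≤ c ^ 2 := by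
        refine (le_abs_self _).trans (abs_integral_le_const fun a ↦ ?_)
        have e : Φ (Fin.cons a l) ^ 2 - 2 * Ψ l * Φ (Fin.cons a l) + Ψ l ^ 2
          = (Φ (Fin.cons a l) - Ψ l) ^ 2 := by ring
        rw [e, abs_pow]
        exact pow_le_pow_left₀ (abs_nonneg _) (hd a) 2
      have h3 : Integrable (fun a ↦ 2 * Ψ l * Φ (Fin.cons a l)) μ := (hintegrable l).const_mul _
      have h4 : Integrable (fun a ↦ Φ (Fin.cons a l) ^ 2 - 2 * Ψ l * Φ (Fin.cons a l)) μ :=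
        (hint2 l).sub h3
      rw [integral_add h4 (integrable_const _), integral_sub (hint2 l) h3,
        integral_const_mul] at h2
      have e : ∫ a, Φ (Fin.cons a l) ∂μ = Ψ l := rfl
      rw [e] at h2
      simp at h2
      nlinarith
    rw [integral_pi_succ, integral_pi_succ, integral_prod_symm _
      (integrable_of_measurable_of_abs_le (hm.pow_const 2) fun _ ↦ hsq _),
      integral_prod_symm _ (integrable_of_measurable_of_abs_le hm fun _ ↦ hK _)]
    have hΨ2 : Integrable (fun l ↦ Ψ l ^ 2) (Measure.pi fun _ : Fin n ↦ μ) :=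
      integrable_of_measurable_of_abs_le (hΨm.pow_const 2) (K := K ^ 2) fun l ↦ by
        rw [abs_pow]; exact pow_le_pow_left₀ (abs_nonneg _) (hΨK l) 2
    calc ∫ l, ∫ a, Φ (Fin.cons a l) ^ 2 ∂μ ∂(Measure.pi fun _ : Fin n ↦ μ)
        ≤ ∫ l, (Ψ l ^ 2 + c ^ 2) ∂(Measure.pi fun _ : Fin n ↦ μ) := by
          refine integral_mono ?_ (hΨ2.add (integrable_const _)) hstep
          exact integrable_of_measurable_of_abs_le
            (measurable_integral_right (hm'.pow_const 2))
            fun a ↦ abs_integral_le_const fun _ ↦ hsq _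
      _ = ∫ l, Ψ l ^ 2 ∂(Measure.pi fun _ : Fin n ↦ μ) + c ^ 2 := by
          rw [integral_add hΨ2 (integrable_const _)]; simp
      _ ≤ _ := by
          push_cast
          simp only [Ψ] at h1 ⊢
          linarith

/-- The first absolute moment of a sum of independent centred variables. -/
lemma integral_abs_sum_pi_le {n : ℕ} {μ : Measure A} [IsProbabilityMeasure μ] {f : Fin n → A → ℝ}
    (hf : ∀ i, MemLp (f i) 2 μ) (h0 : ∀ i, ∫ a, f i a ∂μ = 0) {V : ℝ}
    (hV : ∑ i, ∫ a, f i a ^ 2 ∂μ ≤ V ^ 2) (hV0 : 0 ≤ V) :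
    ∫ l, |∑ i, f i (l i)| ∂(Measure.pi fun _ : Fin n ↦ μ) ≤ V := by
  have hm : ∀ i, MemLp (fun l : Fin n → A ↦ f i (l i)) 2 (Measure.pi fun _ : Fin n ↦ μ) :=
    fun i ↦ (hf i).comp_measurePreserving (measurePreserving_eval (fun _ : Fin n ↦ μ) i)
  have hS : MemLp (fun l : Fin n → A ↦ ∑ i, f i (l i)) 2 (Measure.pi fun _ : Fin n ↦ μ) :=
    memLp_finsetSum _ fun i _ ↦ hm i
  have hvar := variance_sum_pi (μ := fun _ : Fin n ↦ μ) (X := f) hf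
  have hmean : ∫ l, (∑ i, f i (l i)) ∂(Measure.pi fun _ : Fin n ↦ μ) = 0 := by
    rw [integral_finsetSum _ fun i _ ↦ (hm i).integrable (by norm_num)]
    refine Finset.sum_eq_zero fun i _ ↦ ?_
    rw [integral_comp_eval (μ := fun _ : Fin n ↦ μ) (f := f i) (hf i).aestronglyMeasurable, h0]
  have hsq : ∫ l, (∑ i, f i (l i)) ^ 2 ∂(Measure.pi fun _ : Fin n ↦ μ) ≤ V ^ 2 := by
    have e : (∑ i, fun l : Fin n → A ↦ f i (l i)) = fun l ↦ ∑ i, f i (l i) := by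
      ext l; simp
    rw [e, variance_of_integral_eq_zero hS.aestronglyMeasurable.aemeasurable hmean] at hvar
    rw [hvar]
    refine le_trans (le_of_eq (Finset.sum_congr rfl fun i _ ↦ ?_)) hV
    exact variance_of_integral_eq_zero (hf i).aestronglyMeasurable.aemeasurable (h0 i)
  have hv := variance_nonneg (fun l : Fin n → A ↦ |∑ i, f i (l i)|)
    (Measure.pi fun _ : Fin n ↦ μ)
  rw [variance_eq_sub (by simpa using hS.norm)] at hv
  simp only [Pi.pow_apply, sq_abs] at hv
  exact (le_abs_self _).trans (abs_le_of_sq_le_sq (by linarith) hV0)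

end ProductMeasure

section GaussianVector

/-- The standard Gaussian product measure on `Fin n → ℝ`. -/
abbrev gaussPi (n : ℕ) : Measure (Fin n → ℝ) := Measure.pi fun _ : Fin n => gaussianReal 0 1

/-- The first absolute moment of the standard Gaussian distribution. -/
def gaussAbsMoment : ℝ := ∫ x, |x| ∂(gaussianReal 0 1)

lemma integrable_abs_gaussianReal : Integrable (fun x : ℝ ↦ |x|) (gaussianReal 0 1) := by
  simpa using integrable_abs_pow_gaussianReal 1

lemma integrable_id_gaussianReal : Integrable (fun x : ℝ ↦ x) (gaussianReal 0 1) :=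
  (integrable_norm_iff measurable_id.aestronglyMeasurable).1 integrable_abs_gaussianReal

lemma memLp_mul_const_gaussianReal (a : ℝ) : MemLp (fun x : ℝ ↦ x * a) 2 (gaussianReal 0 1) :=
  (memLp_id_gaussianReal 2).mul_const a

lemma gaussAbsMoment_pos : 0 < gaussAbsMoment := by
  refine lt_of_le_of_ne (integral_nonneg fun _ ↦ abs_nonneg _) fun h ↦ ?_
  have h0 := (integral_eq_zero_iff_of_nonneg (fun x ↦ abs_nonneg x)
    integrable_abs_gaussianReal).1 h.symm
  have h1 : ∫ x, x ^ 2 ∂(gaussianReal 0 1) = 0 := by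
    refine integral_eq_zero_of_ae ?_
    filter_upwards [h0] with x hx
    have : x = 0 := by simpa using hx
    simp [this]
  rw [integral_sq_gaussianReal] at h1
  exact one_ne_zero h1

lemma map_add_mul_gaussianReal {a b : ℝ} {v : NNReal} :
    ((gaussianReal 0 1).prod (gaussianReal 0 v)).map (fun p ↦ a * p.1 + b * p.2)
      = gaussianReal 0 (NNReal.mk (a ^ 2) (sq_nonneg a) + NNReal.mk (b ^ 2) (sq_nonneg b) * v) := by
  have h := gaussianReal_conv_gaussianReal (m₁ := 0) (m₂ := 0) (v₁ := NNReal.mk (a ^ 2) (sq_nonneg a))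
    (v₂ := NNReal.mk (b ^ 2) (sq_nonneg b) * v)
  have ha := gaussianReal_map_const_mul (μ := 0) (v := 1) a
  have hb := gaussianReal_map_const_mul (μ := 0) (v := v) b
  rw [mul_zero, mul_one] at ha
  rw [mul_zero] at hb
  rw [← ha, ← hb, Measure.conv, Measure.map_prod_map _ _ (by fun_prop) (by fun_prop),
    Measure.map_map (by fun_prop) (by fun_prop)] at h
  simp only [add_zero] at h
  exact h

/-- Rotation invariance of the standard Gaussian product measure. -/
lemma map_smul_add_smul_gaussPi (n : ℕ) {ρ s : ℝ} (h : ρ ^ 2 + s ^ 2 = 1) :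
    ((gaussPi n).prod (gaussPi n)).map (fun p ↦ ρ • p.1 + s • p.2) = gaussPi n := by
  have h1 : ((gaussianReal 0 1).prod (gaussianReal 0 1)).map (fun p ↦ ρ * p.1 + s * p.2)
      = gaussianReal 0 1 := by
    rw [map_add_mul_gaussianReal]
    congr 1
    ext
    simpa using h
  have h2 := (measurePreserving_arrowProdEquivProdArrow ℝ ℝ (Fin n)
    (fun _ ↦ gaussianReal 0 1) (fun _ ↦ gaussianReal 0 1)).map_eq
  rw [← h2, Measure.map_map (by fun_prop) (MeasurableEquiv.measurable _)]
  have h3 := Measure.pi_map_pi (μ := fun _ : Fin n ↦ (gaussianReal 0 1).prod (gaussianReal 0 1))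
    (f := fun _ p ↦ ρ * p.1 + s * p.2)
    (hμ := fun i ↦ by rw [h1]; infer_instance) (fun i ↦ by fun_prop)
  simp only [h1] at h3
  exact h3

lemma map_sum_mul_gaussPi (n : ℕ) (b : Fin n → ℝ) :
    (gaussPi n).map (fun η ↦ ∑ i, b i * η i) = gaussianReal 0 (∑ i, NNReal.mk (b i ^ 2) (sq_nonneg _)) := by
  induction n with
  | zero => simp [Measure.map_const]
  | succ n ih =>
    have h : ((gaussianReal 0 1).prod (gaussPi n)).map
        (MeasurableEquiv.piFinSuccAbove (fun _ : Fin (n + 1) ↦ ℝ) 0).symm = gaussPi (n + 1) :=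
      (measurePreserving_piFinSuccAbove (fun _ : Fin (n + 1) ↦ gaussianReal 0 1) 0).symm.map_eq
    rw [← h, Measure.map_map (by fun_prop) (MeasurableEquiv.measurable _)]
    have e : ((fun η : Fin (n + 1) → ℝ ↦ ∑ i, b i * η i) ∘
        (MeasurableEquiv.piFinSuccAbove (fun _ : Fin (n + 1) ↦ ℝ) 0).symm)
        = (fun p : ℝ × ℝ ↦ b 0 * p.1 + 1 * p.2) ∘
          (fun p : ℝ × (Fin n → ℝ) ↦ (id p.1, ∑ i : Fin n, b i.succ * p.2 i)) := by
      funext p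
      simp [MeasurableEquiv.piFinSuccAbove, Fin.consEquiv, Fin.sum_univ_succ]
    have e2 := Measure.map_prod_map (gaussianReal 0 1) (gaussPi n) (f := id)
      (g := fun η ↦ ∑ i : Fin n, b i.succ * η i) measurable_id (by fun_prop)
    rw [ih fun i ↦ b i.succ, Measure.map_id] at e2
    rw [e, ← Measure.map_map (by fun_prop) (by fun_prop)]
    erw [← e2]
    rw [map_add_mul_gaussianReal, Fin.sum_univ_succ]
    congr 1
    ext
    simp

lemma integral_abs_sum_mul_gaussPi (n : ℕ) (b : Fin n → ℝ) :
    ∫ η, |∑ i, b i * η i| ∂(gaussPi n) = Real.sqrt (∑ i, b i ^ 2) * gaussAbsMoment := by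
  have h := map_sum_mul_gaussPi n b
  have h2 := gaussianReal_map_const_mul (μ := 0) (v := 1) (Real.sqrt (∑ i, b i ^ 2))
  rw [mul_zero, mul_one] at h2
  have e : NNReal.mk (Real.sqrt (∑ i, b i ^ 2) ^ 2) (sq_nonneg _)
      = ∑ i, NNReal.mk (b i ^ 2) (sq_nonneg _) := by
    ext
    simp [Real.sq_sqrt (Finset.sum_nonneg fun i _ ↦ sq_nonneg (b i))]
  rw [e, ← h] at h2
  have e1 : ∫ η, |∑ i, b i * η i| ∂(gaussPi n)
      = ∫ x, |x| ∂((gaussPi n).map (fun η ↦ ∑ i, b i * η i)) := by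
    rw [integral_map (Measurable.aemeasurable (by fun_prop)) (by fun_prop)]
  rw [e1, ← h2, integral_map (by fun_prop) (by fun_prop), gaussAbsMoment, ← integral_const_mul]
  simp only [abs_mul, abs_of_nonneg (Real.sqrt_nonneg _)]

end GaussianVector

section AntiConcentration

lemma integrable_sum_mul_gaussPi (n : ℕ) (b : Fin n → ℝ) :
    Integrable (fun η : Fin n → ℝ ↦ ∑ i, b i * η i) (gaussPi n) := by
  refine integrable_finsetSum _ fun i _ ↦ Integrable.const_mul ?_ _
  exact ((measurePreserving_eval (fun _ : Fin n ↦ gaussianReal 0 1) i).integrable_comp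
    measurable_id.aestronglyMeasurable).2 integrable_id_gaussianReal

lemma integral_sum_mul_gaussPi (n : ℕ) (b : Fin n → ℝ) :
    ∫ η, ∑ i, b i * η i ∂(gaussPi n) = 0 := by
  have e : ∫ η, ∑ i, b i * η i ∂(gaussPi n)
      = ∫ x, x ∂((gaussPi n).map (fun η ↦ ∑ i, b i * η i)) := by
    rw [integral_map (Measurable.aemeasurable (by fun_prop)) (by fun_prop)]
  rw [e, map_sum_mul_gaussPi, integral_id_gaussianReal]

lemma measurable_sum_smul {J : Type*} {n : ℕ} (a : Fin n → J → ℝ) :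
    Measurable fun ξ : Fin n → ℝ ↦ ∑ i, ξ i • a i := by
  fun_prop

variable {J : Type*} [Fintype J]

lemma integrable_norm_sum_smul_gaussPi {n : ℕ} (a : Fin n → J → ℝ) :
    Integrable (fun ξ : Fin n → ℝ ↦ ‖∑ i, ξ i • a i‖) (gaussPi n) := by
  have h : Integrable (fun ξ : Fin n → ℝ ↦ ∑ i, |ξ i| * ‖a i‖) (gaussPi n) := by
    refine integrable_finsetSum _ fun i _ ↦ Integrable.mul_const ?_ _
    exact ((measurePreserving_eval (fun _ : Fin n ↦ gaussianReal 0 1) i).integrable_comp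
      (by fun_prop)).2 integrable_abs_gaussianReal
  refine h.mono' (measurable_sum_smul a).norm.aestronglyMeasurable (ae_of_all _ fun ξ ↦ ?_)
  rw [norm_norm]
  refine (norm_sum_le _ _).trans (Finset.sum_le_sum fun i _ ↦ ?_)
  rw [norm_smul, Real.norm_eq_abs]

lemma exists_signed_coord_eq_norm [Nonempty J] (w : J → ℝ) :
    ∃ (j : J) (θ : ℝ), |θ| = 1 ∧ θ * w j = ‖w‖ := by
  obtain ⟨j, hj'⟩ := Finite.exists_max fun j ↦ ‖w j‖
  have hj : ‖w j‖ = ‖w‖ :=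
    le_antisymm (norm_le_pi_norm w j) ((pi_norm_le_iff_of_nonempty w).2 hj')
  rcases le_total 0 (w j) with h | h
  · exact ⟨j, 1, by simp, by rw [one_mul, ← hj, Real.norm_of_nonneg h]⟩
  · exact ⟨j, -1, by simp, by rw [← hj, Real.norm_of_nonpos h]; ring⟩

lemma max_add_le_integral_max {n : ℕ} (b : Fin n → ℝ) {u κ : ℝ}
    (hκ : 4 * κ ≤ ∫ η, |∑ i, b i * η i| ∂(gaussPi n)) :
    max u 0 + (if |u| ≤ κ then κ else 0) ≤ ∫ η, max (u + ∑ i, b i * η i) 0 ∂(gaussPi n) := by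
  have hi := integrable_sum_mul_gaussPi n b
  have hui : Integrable (fun η : Fin n → ℝ ↦ u + ∑ i, b i * η i) (gaussPi n) :=
    (integrable_const u).add hi
  have h0 : ∫ η, (u + ∑ i, b i * η i) ∂(gaussPi n) = u := by
    rw [integral_add (integrable_const u) hi, integral_sum_mul_gaussPi]; simp
  have e : ∫ η, max (u + ∑ i, b i * η i) 0 ∂(gaussPi n)
      = (u + ∫ η, |u + ∑ i, b i * η i| ∂(gaussPi n)) / 2 := by
    have e1 : ∀ η : Fin n → ℝ, max (u + ∑ i, b i * η i) 0
        = ((u + ∑ i, b i * η i) + |u + ∑ i, b i * η i|) / 2 := fun η ↦ by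
      rcases le_total 0 (u + ∑ i, b i * η i) with h | h
      · rw [max_eq_left h, abs_of_nonneg h]; ring
      · rw [max_eq_right h, abs_of_nonpos h]; ring
    simp only [e1]
    rw [integral_div, integral_add hui hui.abs, h0]
  have h1 : |u| ≤ ∫ η, |u + ∑ i, b i * η i| ∂(gaussPi n) := by
    conv_lhs => rw [← h0]
    exact abs_integral_le_integral_abs
  have h2 : ∫ η, |∑ i, b i * η i| ∂(gaussPi n) - |u|
      ≤ ∫ η, |u + ∑ i, b i * η i| ∂(gaussPi n) := by
    have e2 : ∫ η, |∑ i, b i * η i| ∂(gaussPi n) - |u|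
        = ∫ η, (|∑ i, b i * η i| - |u|) ∂(gaussPi n) := by
      rw [integral_sub hi.abs (integrable_const _)]; simp
    rw [e2]
    refine integral_mono (hi.abs.sub (integrable_const _)) hui.abs fun η ↦ ?_
    have := abs_sub (u + ∑ i, b i * η i) u
    simp only [add_sub_cancel_left] at this
    dsimp only
    linarith
  rw [e]
  rcases le_total 0 u with h | h
  · rw [max_eq_left h]
    rw [abs_of_nonneg h] at h1 h2 ⊢
    split_ifs <;> linarith
  · rw [max_eq_right h]
    rw [abs_of_nonpos h] at h1 h2 ⊢
    split_ifs <;> linarith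

/-- Anti-concentration of the maximum of a Gaussian vector, with a constant involving only the
expected maximum and a lower bound on the coordinate variances. -/
lemma gaussPi_real_abs_norm_sub_le [Nonempty J] {n : ℕ} (a : Fin n → J → ℝ) {v K c : ℝ}
    (hv : 0 < v) (hva : ∀ j, v ^ 2 ≤ ∑ i, a i j ^ 2)
    (hK : ∫ ξ, ‖∑ i, ξ i • a i‖ ∂(gaussPi n) ≤ K) (hc : c = v * gaussAbsMoment / 4)
    (z : ℝ) {r : ℝ} (hr : 0 < r) :
    (gaussPi n).real {ξ | |‖∑ i, ξ i • a i‖ - z| ≤ r} ≤ r * (K / c ^ 2 + 1 / c) := by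
  have hc0 : 0 < c := by rw [hc]; have := gaussAbsMoment_pos; positivity
  have hK0 : 0 ≤ K := (integral_nonneg fun _ ↦ norm_nonneg _).trans hK
  rcases lt_or_ge c r with hrc | hrc
  · calc (gaussPi n).real {ξ | |‖∑ i, ξ i • a i‖ - z| ≤ r} ≤ 1 := measureReal_le_one
      _ ≤ r * (1 / c) := by rw [mul_one_div, one_le_div hc0]; exact hrc.le
      _ ≤ _ := by gcongr; have : 0 ≤ K / c ^ 2 := by positivity
                  linarith
  set s := r / c with hs
  have hs0 : 0 < s := by positivity
  have hs1 : s ≤ 1 := (div_le_one hc0).2 hrc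
  have hrs : r = s * c := by rw [hs]; field_simp
  set ρ := Real.sqrt (1 - s ^ 2) with hρ
  have hs2 : s ^ 2 ≤ 1 := pow_le_one₀ hs0.le hs1
  have hρ2 : ρ ^ 2 = 1 - s ^ 2 := Real.sq_sqrt (by linarith)
  have hρ0 : 0 ≤ ρ := Real.sqrt_nonneg _
  have hρ1 : ρ ≤ 1 := by nlinarith
  have hρs : 1 - ρ ≤ s ^ 2 := by nlinarith
  let M : (Fin n → ℝ) → ℝ := fun ξ ↦ ‖∑ i, ξ i • a i‖
  have hMm : Measurable M := (measurable_sum_smul a).norm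
  have hMi : Integrable M (gaussPi n) := integrable_norm_sum_smul_gaussPi a
  have hM0 : ∀ ξ, 0 ≤ M ξ := fun ξ ↦ norm_nonneg _
  set S : Set (Fin n → ℝ) := {ξ | |ρ * M ξ - ρ * z| ≤ r} with hS
  have hSm : MeasurableSet S :=
    measurableSet_le ((hMm.const_mul ρ).sub_const _).abs measurable_const
  have hsub : {ξ : Fin n → ℝ | |‖∑ i, ξ i • a i‖ - z| ≤ r} ⊆ S := fun ξ hξ ↦ by
    simp only [mem_ofPred_eq, hS, ← mul_sub, abs_mul, abs_of_nonneg hρ0, M] at hξ ⊢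
    exact (mul_le_of_le_one_left (abs_nonneg _) hρ1).trans hξ
  have hg : Integrable (fun ξ ↦ max (M ξ - ρ * z) 0) (gaussPi n) :=
    (hMi.sub (integrable_const _)).sup (integrable_const 0)
  have hrot := map_smul_add_smul_gaussPi n (ρ := ρ) (s := s) (by linarith)
  have hrm : Measurable fun p : (Fin n → ℝ) × (Fin n → ℝ) ↦ ρ • p.1 + s • p.2 := by fun_prop
  have hgp : Integrable (fun p : (Fin n → ℝ) × (Fin n → ℝ) ↦
      max (M (ρ • p.1 + s • p.2) - ρ * z) 0) ((gaussPi n).prod (gaussPi n)) := by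
    rw [← hrot] at hg
    exact hg.comp_measurable hrm
  have hpt : ∀ᵐ ξ ∂(gaussPi n), max (M ξ - ρ * z) 0 - s ^ 2 * M ξ + S.indicator (fun _ ↦ r) ξ
      ≤ ∫ η, max (M (ρ • ξ + s • η) - ρ * z) 0 ∂(gaussPi n) := by
    filter_upwards [hgp.prod_right_ae] with ξ hξ
    obtain ⟨j, θ, hθ, hj⟩ := exists_signed_coord_eq_norm (∑ i, ξ i • a i)
    have hlow : ∀ η : Fin n → ℝ,
        ρ * M ξ + ∑ i, s * θ * a i j * η i ≤ M (ρ • ξ + s • η) := fun η ↦ by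
      have e : ρ * M ξ + ∑ i, s * θ * a i j * η i
          = θ * (∑ i, (ρ • ξ + s • η) i • a i) j := by
        simp only [M, ← hj, Finset.sum_apply, Pi.smul_apply, Pi.add_apply, smul_eq_mul,
          Finset.mul_sum, ← Finset.sum_add_distrib]
        exact Finset.sum_congr rfl fun i _ ↦ by ring
      rw [e]
      refine (le_abs_self _).trans ?_
      rw [abs_mul, hθ, one_mul]
      exact norm_le_pi_norm (∑ i, (ρ • ξ + s • η) i • a i) j
    have hκ : 4 * r ≤ ∫ η, |∑ i, s * θ * a i j * η i| ∂(gaussPi n) := by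
      rw [integral_abs_sum_mul_gaussPi]
      have h1 : s * v ≤ Real.sqrt (∑ i, (s * θ * a i j) ^ 2) := by
        refine Real.le_sqrt_of_sq_le ?_
        have hθ2 : θ ^ 2 = 1 := by rw [← sq_abs, hθ, one_pow]
        simp only [mul_pow, hθ2, mul_one, ← Finset.mul_sum]
        exact mul_le_mul_of_nonneg_left (hva j) (sq_nonneg s)
      have h2 := mul_le_mul_of_nonneg_right h1 gaussAbsMoment_pos.le
      have h3 : 4 * r = s * v * gaussAbsMoment := by rw [hrs, hc]; ring
      linarith
    have h1 := max_add_le_integral_max (fun i ↦ s * θ * a i j) (u := ρ * M ξ - ρ * z) hκ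
    have h2 : ∫ η, max (ρ * M ξ - ρ * z + ∑ i, s * θ * a i j * η i) 0 ∂(gaussPi n)
        ≤ ∫ η, max (M (ρ • ξ + s • η) - ρ * z) 0 ∂(gaussPi n) := by
      refine integral_mono_of_nonneg (ae_of_all _ fun η ↦ le_max_right _ _) hξ
        (ae_of_all _ fun η ↦ max_le_max ?_ le_rfl)
      linarith [hlow η]
    have h3 : max (M ξ - ρ * z) 0 - s ^ 2 * M ξ ≤ max (ρ * M ξ - ρ * z) 0 := by
      have h4 := mul_le_mul_of_nonneg_right hρs (hM0 ξ)
      have h5 := mul_nonneg (sq_nonneg s) (hM0 ξ)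
      have h6 := le_max_left (ρ * M ξ - ρ * z) 0
      have h7 := le_max_right (ρ * M ξ - ρ * z) 0
      rcases max_cases (M ξ - ρ * z) 0 with ⟨h, _⟩ | ⟨h, _⟩ <;> rw [h] <;> linarith
    have h8 : S.indicator (fun _ ↦ r) ξ = if |ρ * M ξ - ρ * z| ≤ r then r else 0 := by
      simp [indicator_apply, hS]
    rw [h8]
    linarith
  have hI : ∫ ξ, max (M ξ - ρ * z) 0 ∂(gaussPi n)
      = ∫ ξ, ∫ η, max (M (ρ • ξ + s • η) - ρ * z) 0 ∂(gaussPi n) ∂(gaussPi n) := by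
    rw [← integral_prod _ hgp]
    conv_lhs => rw [← hrot]
    rw [integral_map hrm.aemeasurable]
    exact ((hMm.sub_const _).max measurable_const).aestronglyMeasurable
  have hind : Integrable (S.indicator fun _ ↦ r) (gaussPi n) :=
    (integrable_const r).indicator hSm
  have hsM : Integrable (fun ξ ↦ s ^ 2 * M ξ) (gaussPi n) := hMi.const_mul _
  have hA : Integrable (fun ξ ↦ max (M ξ - ρ * z) 0 - s ^ 2 * M ξ) (gaussPi n) := hg.sub hsM
  have hmono := integral_mono_ae (hA.add hind) hgp.integral_prod_left hpt
  simp only [Pi.add_apply] at hmono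
  rw [← hI, integral_add hA hind, integral_sub hg hsM, integral_const_mul,
    integral_indicator_const _ hSm, smul_eq_mul] at hmono
  have h3 : (gaussPi n).real S * r ≤ s ^ 2 * K := by
    have := mul_le_mul_of_nonneg_left hK (sq_nonneg s)
    simp only [M] at hmono
    linarith
  calc (gaussPi n).real {ξ | |‖∑ i, ξ i • a i‖ - z| ≤ r} ≤ (gaussPi n).real S :=
        measureReal_mono hsub
    _ ≤ s ^ 2 * K / r := by rwa [le_div_iff₀ hr]
    _ = r * (K / c ^ 2) := by rw [hs]; field_simp
    _ ≤ _ := by gcongr; have : 0 ≤ 1 / c := by positivity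
                linarith

end AntiConcentration

section Chaining

lemma abs_le_abs_zero_add_sum {m : ℕ} (w : Fin (m + 1) → ℝ) (j : Fin (m + 1)) :
    |w j| ≤ |w 0| + ∑ k : Fin m, |w k.succ - w k.castSucc| := by
  induction m with
  | zero => simp [Fin.fin_one_eq_zero j]
  | succ m ih =>
    rw [Fin.sum_univ_castSucc]
    have h := ih (fun k ↦ w k.castSucc)
    simp only [Fin.castSucc_zero] at h
    refine Fin.lastCases ?_ (fun i ↦ ?_) j
    · have h1 := h (Fin.last m)
      have h2 := abs_sub_abs_le_abs_sub (w (Fin.last (m + 1))) (w (Fin.last m).castSucc)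
      simp only [Fin.succ_last, Nat.succ_eq_add_one, Fin.succ_castSucc] at h1 h2 ⊢
      linarith
    · have h1 := h i
      have h2 := abs_nonneg (w (Fin.last m).succ - w (Fin.last m).castSucc)
      simp only [Fin.succ_castSucc] at h1 h2 ⊢
      linarith

variable {A : Type*} [MeasurableSpace A]

/-- A maximal inequality for sums of independent centred vectors whose consecutive coordinates
are close to each other. -/
lemma integral_norm_sum_pi_le {m n : ℕ} {μ : Measure A} [IsProbabilityMeasure μ]
    {f : Fin n → A → Fin (m + 1) → ℝ} (hf : ∀ i j, MemLp (fun a ↦ f i a j) 2 μ)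
    (h0 : ∀ i j, ∫ a, f i a j ∂μ = 0) {V D : ℝ} (hV0 : 0 ≤ V) (hD0 : 0 ≤ D)
    (hV : ∑ i, ∫ a, f i a 0 ^ 2 ∂μ ≤ V ^ 2)
    (hD : ∀ j : Fin m, ∑ i, ∫ a, (f i a j.succ - f i a j.castSucc) ^ 2 ∂μ ≤ D ^ 2) :
    ∫ l, ‖∑ i, f i (l i)‖ ∂(Measure.pi fun _ : Fin n ↦ μ) ≤ V + m * D := by
  have hsum : ∀ g : Fin n → A → ℝ, (∀ i, MemLp (g i) 2 μ) →
      Integrable (fun l : Fin n → A ↦ |∑ i, g i (l i)|) (Measure.pi fun _ : Fin n ↦ μ) :=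
    fun g hg ↦ Integrable.abs (integrable_finsetSum _ fun i _ ↦
      ((measurePreserving_eval (fun _ : Fin n ↦ μ) i).integrable_comp
        (hg i).aestronglyMeasurable).2 ((hg i).integrable (by norm_num)))
  have hd : ∀ (j : Fin m) i, MemLp (fun a ↦ f i a j.succ - f i a j.castSucc) 2 μ :=
    fun j i ↦ (hf i j.succ).sub (hf i j.castSucc)
  have hi0 := hsum (fun i a ↦ f i a 0) fun i ↦ hf i 0
  have hid : ∀ j : Fin m, _ := fun j ↦ hsum _ (hd j)
  have hiS := integrable_finsetSum Finset.univ fun j _ ↦ hid j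
  calc ∫ l, ‖∑ i, f i (l i)‖ ∂(Measure.pi fun _ : Fin n ↦ μ)
      ≤ ∫ l, (|∑ i, f i (l i) 0| +
          ∑ j : Fin m, |∑ i, (f i (l i) j.succ - f i (l i) j.castSucc)|)
          ∂(Measure.pi fun _ : Fin n ↦ μ) := by
        refine integral_mono_of_nonneg (ae_of_all _ fun _ ↦ norm_nonneg _) (hi0.add hiS)
          (ae_of_all _ fun l ↦ ?_)
        refine (pi_norm_le_iff_of_nonempty _).2 fun j ↦ ?_
        have := abs_le_abs_zero_add_sum (∑ i, f i (l i)) j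
        simpa only [Finset.sum_apply, Real.norm_eq_abs, ← Finset.sum_sub_distrib] using this
    _ = ∫ l, |∑ i, f i (l i) 0| ∂(Measure.pi fun _ : Fin n ↦ μ) + ∑ j : Fin m,
          ∫ l, |∑ i, (f i (l i) j.succ - f i (l i) j.castSucc)|
            ∂(Measure.pi fun _ : Fin n ↦ μ) := by
        rw [integral_add hi0 hiS, integral_finsetSum _ fun j _ ↦ hid j]
    _ ≤ V + ∑ _j : Fin m, D := by
        refine add_le_add (integral_abs_sum_pi_le (fun i ↦ hf i 0) (fun i ↦ h0 i 0) hV hV0)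
          (Finset.sum_le_sum fun j _ ↦ integral_abs_sum_pi_le (hd j) (fun i ↦ ?_) (hD j) hD0)
        rw [integral_sub ((hf i _).integrable (by norm_num)) ((hf i _).integrable (by norm_num)),
          h0, h0, sub_zero]
    _ = V + m * D := by simp

lemma integral_norm_gaussian_multiplier_le {n : ℕ} {h B Λ : ℝ} (hn : n * h ^ 2 = 1) (hB : 0 ≤ B)
    (hΛ : 0 ≤ Λ) {x : Fin n → Fin (n + 1) → ℝ} (hx : ∀ i j, |x i j| ≤ B)
    (hd : ∀ i (j : Fin n), |x i j.succ - x i j.castSucc| ≤ Λ / n) :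
    ∫ ξ, ‖∑ i, (ξ i * h) • x i‖ ∂(gaussPi n) ≤ B + Λ := by
  have hn0 : (n : ℝ) ≠ 0 := fun e ↦ by simp [e] at hn
  have key : ∀ (y : Fin n → ℝ) (R : ℝ), (∀ i, |y i| ≤ R) →
      ∑ i, ∫ ξ, (ξ * (h * y i)) ^ 2 ∂(gaussianReal 0 1) ≤ R ^ 2 := fun y R hy ↦ by
    have e : ∀ i, ∫ ξ, (ξ * (h * y i)) ^ 2 ∂(gaussianReal 0 1) = h ^ 2 * y i ^ 2 := fun i ↦ by
      simp only [mul_pow, integral_mul_const, integral_sq_gaussianReal, one_mul]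
    calc ∑ i, ∫ ξ, (ξ * (h * y i)) ^ 2 ∂(gaussianReal 0 1) = ∑ i, h ^ 2 * y i ^ 2 :=
          Finset.sum_congr rfl fun i _ ↦ e i
      _ ≤ ∑ _i : Fin n, h ^ 2 * R ^ 2 := by
          refine Finset.sum_le_sum fun i _ ↦ mul_le_mul_of_nonneg_left ?_ (sq_nonneg h)
          exact sq_le_sq' (neg_le_of_abs_le (hy i)) (le_of_abs_le (hy i))
      _ = n * h ^ 2 * R ^ 2 := by simp; ring
      _ = R ^ 2 := by rw [hn, one_mul]
  have := integral_norm_sum_pi_le (m := n) (n := n) (μ := gaussianReal 0 1)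
    (f := fun i ξ ↦ (ξ * h) • x i) (V := B) (D := Λ / n)
    (fun i j ↦ by simpa [mul_assoc] using memLp_mul_const_gaussianReal (h * x i j))
    (fun i j ↦ by simp [mul_assoc, integral_mul_const]) hB (by positivity)
    (by simpa [mul_assoc] using key (fun i ↦ x i 0) B fun i ↦ hx i 0)
    (fun j ↦ by
      simpa [mul_assoc, ← mul_sub] using key (fun i ↦ x i j.succ - x i j.castSucc) _ (hd · j))
  rwa [mul_div_cancel₀ _ hn0] at this

lemma integral_norm_average_le {n : ℕ} {μ : Measure A} [IsProbabilityMeasure μ] {h B Λ : ℝ}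
    (hn : n * h ^ 2 = 1) (hh : 0 ≤ h) (hB : 0 ≤ B) (hΛ : 0 ≤ Λ) {Y : A → Fin (n + 1) → ℝ}
    (hY : Measurable Y) (hYB : ∀ a j, |Y a j| ≤ B)
    (hd : ∀ a (j : Fin n), |Y a j.succ - Y a j.castSucc| ≤ Λ / n)
    (h0 : ∀ j, ∫ a, Y a j ∂μ = 0) :
    ∫ l, ‖∑ i, h ^ 2 • Y (l i)‖ ∂(Measure.pi fun _ : Fin n ↦ μ) ≤ (B + Λ) * h := by
  have hn0 : (n : ℝ) ≠ 0 := fun e ↦ by simp [e] at hn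
  have key : ∀ (y : A → ℝ) (R : ℝ), (∀ a, |y a| ≤ R) →
      ∑ _i : Fin n, ∫ a, (h ^ 2 * y a) ^ 2 ∂μ ≤ (R * h) ^ 2 := fun y R hy ↦ by
    have e : ∫ a, (h ^ 2 * y a) ^ 2 ∂μ ≤ h ^ 4 * R ^ 2 := by
      refine (le_abs_self _).trans (abs_integral_le_const fun a ↦ ?_)
      rw [abs_of_nonneg (sq_nonneg _), mul_pow, ← pow_mul]
      refine mul_le_mul_of_nonneg_left ?_ (by positivity)
      exact sq_le_sq' (neg_le_of_abs_le (hy a)) (le_of_abs_le (hy a))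
    calc ∑ _i : Fin n, ∫ a, (h ^ 2 * y a) ^ 2 ∂μ ≤ ∑ _i : Fin n, h ^ 4 * R ^ 2 := by gcongr
      _ = n * h ^ 2 * (R * h) ^ 2 := by simp; ring
      _ = (R * h) ^ 2 := by rw [hn, one_mul]
  have hYj : ∀ j, Measurable fun a ↦ Y a j := fun j ↦ (measurable_pi_apply j).comp hY
  have := integral_norm_sum_pi_le (m := n) (n := n) (μ := μ)
    (f := fun _ a ↦ h ^ 2 • Y a) (V := B * h) (D := Λ / n * h)
    (fun i j ↦ MemLp.of_bound ((hYj j).const_mul (h ^ 2)).aestronglyMeasurable (h ^ 2 * B)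
      (ae_of_all _ fun a ↦ by
        rw [Pi.smul_apply, smul_eq_mul, norm_mul, norm_pow, Real.norm_of_nonneg hh]
        exact mul_le_mul_of_nonneg_left (hYB a j) (sq_nonneg h)))
    (fun i j ↦ by simp [integral_const_mul, h0]) (by positivity) (by positivity)
    (by simpa using key (fun a ↦ Y a 0) B fun a ↦ hYB a 0)
    (fun j ↦ by
      simpa [← mul_sub] using key (fun a ↦ Y a j.succ - Y a j.castSucc) _ (hd · j))
  refine this.trans_eq ?_
  field_simp

end Chaining

section MultiplierComparison

variable {E : Type*} [MeasurableSpace E]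

/-- The multiplier sum `∑ i, ξ i h X (l i)`. -/
def multSum {E J : Type*} {n : ℕ} (h : ℝ) (X : E → J → ℝ) (l : Fin n → E) (ξ : Fin n → ℝ) : J → ℝ :=
  ∑ i, (ξ i * h) • X (l i)

lemma measurable_multSum_uncurry {J : Type*} {n : ℕ} {h : ℝ} {X : E → J → ℝ} (hX : Measurable X) :
    Measurable fun p : (Fin n → E) × (Fin n → ℝ) ↦ multSum h X p.1 p.2 := by
  refine Finset.measurable_sum _ fun i _ ↦ ?_
  have h1 : Measurable fun p : (Fin n → E) × (Fin n → ℝ) ↦ p.2 i * h := by fun_prop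
  have h2 : Measurable fun p : (Fin n → E) × (Fin n → ℝ) ↦ X (p.1 i) :=
    hX.comp (by fun_prop)
  exact measurable_pi_lambda _ fun j ↦ h1.mul ((measurable_pi_apply j).comp h2)

lemma measurable_multSum {E J : Type*} {n : ℕ} {h : ℝ} (X : E → J → ℝ) (l : Fin n → E) :
    Measurable (multSum h X l) := by
  unfold multSum; fun_prop

variable {J : Type*} [Fintype J] [Nonempty J]

lemma abs_integral_smoothExceed_update_sub_le {n : ℕ} {ε B : ℝ} (z : ℝ) (hℓ : 1 ≤ logCard J)
    (hε : 0 < ε) (h : ℝ) (x : Fin n → J → ℝ) (i : Fin n) (hx : ∀ j, |x i j| ≤ B) :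
    |∫ ξ, smoothExceed ε z (∑ k, (ξ k * h) • x k) ∂(gaussPi n)
      - ∫ ξ, smoothExceed ε z (∑ k, (ξ k * h) • Function.update x i 0 k) ∂(gaussPi n)|
      ≤ 3 * (smoothBound / logCard J) * (logCard J / ε * B) ^ 2 * h ^ 2 := by
  cases n with
  | zero => exact i.elim0
  | succ m =>
    have hsplit : ∀ F : (Fin (m + 1) → ℝ) → ℝ, ∫ ξ, F ξ ∂(gaussPi (m + 1))
        = ∫ p, F (i.insertNth p.1 p.2) ∂((gaussianReal 0 1).prod (gaussPi m)) := fun F ↦ by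
      rw [← (measurePreserving_piFinSuccAbove (fun _ : Fin (m + 1) ↦ gaussianReal 0 1)
        i).symm.integral_comp' F]
      refine integral_congr_ae (ae_of_all _ fun p ↦ ?_)
      simp [MeasurableEquiv.piFinSuccAbove, Fin.insertNthEquiv]
    have hm : Measurable fun p : ℝ × (Fin m → ℝ) ↦
        ∑ k, (p.2 k * h) • x (i.succAbove k) + (p.1 * h) • x i := by fun_prop
    have hm0 : Measurable fun p : ℝ × (Fin m → ℝ) ↦
        ∑ k, (p.2 k * h) • x (i.succAbove k) := by fun_prop
    rw [hsplit, hsplit]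
    simp only [Fin.sum_univ_succAbove _ i, Fin.insertNth_apply_same,
      Fin.insertNth_apply_succAbove, Function.update_self, ne_eq, Fin.succAbove_ne,
      not_false_eq_true, Function.update_of_ne, smul_zero, zero_add]
    simp only [add_comm ((_ * h) • x i)]
    rw [integral_prod_symm _ (integrable_smoothExceed_comp ε z hm),
      integral_prod_symm _ (integrable_smoothExceed_comp ε z hm0), ← integral_sub]
    · refine abs_integral_le_const fun ξ ↦ ?_
      simpa using abs_integral_smoothExceed_sub_le z hℓ hε
        (∑ k, (ξ k * h) • x (i.succAbove k)) hx h
    · exact (integrable_smoothExceed_comp ε z hm).integral_prod_right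
    · exact (integrable_smoothExceed_comp ε z hm0).integral_prod_right

/-- The conditional expectation, given the sample, of the smoothed exceedance indicator of the
multiplier sum. -/
def smoothProb {E J : Type*} [Fintype J] {n : ℕ} (h : ℝ) (X : E → J → ℝ) (ε z : ℝ) (l : Fin n → E) : ℝ :=
  ∫ ξ, smoothExceed ε z (multSum h X l ξ) ∂(gaussPi n)

lemma measurable_smoothProb {n : ℕ} {h : ℝ} {X : E → J → ℝ} (hX : Measurable X) (ε z : ℝ) :
    Measurable (smoothProb h X ε z : (Fin n → E) → ℝ) :=
  measurable_integral_right
    ((continuous_smoothExceed ε z).measurable.comp (measurable_multSum_uncurry hX))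

lemma abs_smoothProb_le_one {E J : Type*} [Fintype J] {n : ℕ} (h : ℝ) (X : E → J → ℝ) (ε z : ℝ) (l : Fin n → E) :
    |smoothProb h X ε z l| ≤ 1 :=
  abs_integral_le_const fun _ ↦ abs_smoothExceed_le_one _ _ _

lemma integrable_smoothProb {n : ℕ} {P : Measure E} [IsProbabilityMeasure P] {h : ℝ}
    {X : E → J → ℝ} (hX : Measurable X) (ε z : ℝ) :
    Integrable (smoothProb h X ε z) (Measure.pi fun _ : Fin n ↦ P) :=
  integrable_of_measurable_of_abs_le (measurable_smoothProb hX ε z) (abs_smoothProb_le_one h X ε z)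

lemma abs_smoothProb_update_sub_le {E : Type*} {n : ℕ} {ε B : ℝ} (z : ℝ) (hℓ : 1 ≤ logCard J)
    (hε : 0 < ε) (h : ℝ) {X : E → J → ℝ} (hXB : ∀ a j, |X a j| ≤ B) (l : Fin n → E) (i : Fin n)
    (a : E) :
    |smoothProb h X ε z (Function.update l i a) - smoothProb h X ε z l|
      ≤ 6 * (smoothBound / logCard J) * (logCard J / ε * B) ^ 2 * h ^ 2 := by
  have e : ∀ l : Fin n → E, smoothProb h X ε z l
      = ∫ ξ, smoothExceed ε z (∑ k, (ξ k * h) • X (l k)) ∂(gaussPi n) := fun l ↦ rfl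
  have e2 : Function.update (fun k ↦ X (Function.update l i a k)) i 0
      = Function.update (fun k ↦ X (l k)) i 0 := by
    funext k
    by_cases hk : k = i
    · subst hk; simp
    · simp [hk]
  have h1 := abs_integral_smoothExceed_update_sub_le z hℓ hε h
    (fun k ↦ X (Function.update l i a k)) i (hXB _)
  have h2 := abs_integral_smoothExceed_update_sub_le z hℓ hε h (fun k ↦ X (l k)) i (hXB _)
  rw [e2, ← e] at h1
  rw [← e] at h2
  have h1' := abs_le.1 h1
  have h2' := abs_le.1 h2
  rw [abs_le]
  constructor <;> linarith

/-- The smoothed conditional exceedance probability concentrates around its mean. -/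
lemma measureReal_smoothProb_lt_le {n : ℕ} {P : Measure E} [IsProbabilityMeasure P] {ε B h : ℝ}
    (z : ℝ) (hℓ : 1 ≤ logCard J) (hε : 0 < ε) {X : E → J → ℝ}
    (hX : Measurable X) (hXB : ∀ a j, |X a j| ≤ B) :
    (Measure.pi fun _ : Fin n ↦ P).real {l | smoothProb h X ε z l
        < ∫ l, smoothProb h X ε z l ∂(Measure.pi fun _ : Fin n ↦ P) - ε}
      ≤ n * (6 * (smoothBound / logCard J) * (logCard J / ε * B) ^ 2 * h ^ 2) ^ 2 / ε ^ 2 := by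
  set Q := Measure.pi fun _ : Fin n ↦ P
  set m := ∫ l, smoothProb h X ε z l ∂Q with hm
  have hi : Integrable (smoothProb h X ε z) Q := integrable_smoothProb hX ε z
  have hi2 : Integrable (fun l ↦ smoothProb h X ε z l ^ 2) Q :=
    integrable_of_measurable_of_abs_le ((measurable_smoothProb hX ε z).pow_const 2) (K := 1)
      fun l ↦ by rw [abs_pow]; exact pow_le_one₀ (abs_nonneg _) (abs_smoothProb_le_one h X ε z l)
  have hES := integral_sq_pi_le_of_bounded_diff (μ := P) n
    (measurable_smoothProb (h := h) hX ε z) (abs_smoothProb_le_one h X ε z)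
    (abs_smoothProb_update_sub_le z hℓ hε h hXB)
  have hi3 : Integrable (fun l ↦ 2 * m * smoothProb h X ε z l) Q := hi.const_mul _
  have hi4 : Integrable
      (fun l ↦ smoothProb h X ε z l ^ 2 - 2 * m * smoothProb h X ε z l) Q := hi2.sub hi3
  have hvar : ∫ l, (smoothProb h X ε z l - m) ^ 2 ∂Q
      ≤ n * (6 * (smoothBound / logCard J) * (logCard J / ε * B) ^ 2 * h ^ 2) ^ 2 := by
    have e : ∀ l : Fin n → E, (smoothProb h X ε z l - m) ^ 2
        = smoothProb h X ε z l ^ 2 - 2 * m * smoothProb h X ε z l + m ^ 2 := fun l ↦ by ring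
    simp only [e]
    rw [integral_add hi4 (integrable_const _), integral_sub hi2 hi3, integral_const_mul, ← hm]
    simp only [integral_const, probReal_univ, smul_eq_mul, one_mul]
    linarith
  have hintegrable : Integrable (fun l ↦ (smoothProb h X ε z l - m) ^ 2) Q :=
    ((hi4.add (integrable_const (m ^ 2)))).congr (ae_of_all _ fun l ↦ by
      simp only [Pi.add_apply]; ring)
  have hmk := mul_meas_ge_le_integral_of_nonneg (μ := Q) (ae_of_all _ fun l ↦ sq_nonneg _) hintegrable
    (ε ^ 2)
  rw [le_div_iff₀ (by positivity), mul_comm]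
  refine le_trans (le_trans (mul_le_mul_of_nonneg_left ?_ (sq_nonneg ε)) hmk) hvar
  refine measureReal_mono fun l hl ↦ ?_
  simp only [mem_ofPred_eq] at hl ⊢
  nlinarith

/-- Comparison of an i.i.d. sum with its multiplier version (Lindeberg's method). -/
lemma abs_integral_smoothExceed_sum_sub_le {n : ℕ} {P : Measure E} [IsProbabilityMeasure P]
    {ε B h : ℝ} (z : ℝ) (hℓ : 1 ≤ logCard J) (hε : 0 < ε) (hh : 0 ≤ h) {X : E → J → ℝ}
    (hX : Measurable X) (hXB : ∀ a j, |X a j| ≤ B) (h0 : ∀ j, ∫ a, X a j ∂P = 0) :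
    |∫ l, smoothExceed ε z (∑ i, h • X (l i)) ∂(Measure.pi fun _ : Fin n ↦ P)
      - ∫ l, smoothProb h X ε z l ∂(Measure.pi fun _ : Fin n ↦ P)|
      ≤ n * (13 * (smoothBound / logCard J) * (logCard J / ε * B) ^ 3 * h ^ 3
        * (1 + gaussAbsMomentThree)) := by
  have hΘ := (continuous_smoothExceed ε z : Continuous (smoothExceed ε z : (J → ℝ) → ℝ)).measurable
  have hf : Measurable fun a ↦ h • X a := hX.const_smul h
  have hg : Measurable fun p : E × ℝ ↦ (p.2 * h) • X p.1 :=
    (measurable_snd.mul_const h).smul (hX.comp measurable_fst)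
  have hXi : ∀ j, Integrable (fun a ↦ X a j) P := fun j ↦
    integrable_of_measurable_of_abs_le ((measurable_pi_apply j).comp hX) (hXB · j)
  have key := abs_integral_sum_pi_sub_le (μ := P) (ν := P.prod (gaussianReal 0 1)) hf hg hΘ
    (abs_smoothExceed_le_one ε z) (δ := 13 * (smoothBound / logCard J) * (logCard J / ε * B) ^ 3
      * h ^ 3 * (1 + gaussAbsMomentThree)) (fun w ↦ by
    obtain ⟨c, hc⟩ := abs_smoothExceed_sub_integral_le (B := B) z hℓ hε w
    have hlin : Integrable (fun a ↦ ∑ j, c j * X a j * h) P :=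
      integrable_finsetSum _ fun j _ ↦ ((hXi j).const_mul (c j)).mul_const h
    have hlin0 : ∫ a, ∑ j, c j * X a j * h ∂P = 0 := by
      rw [integral_finsetSum _ fun j _ ↦ ((hXi j).const_mul (c j)).mul_const h]
      simp [integral_mul_const, integral_const_mul, h0]
    have hi1 : Integrable (fun a ↦ smoothExceed ε z (w + h • X a)) P :=
      integrable_smoothExceed_comp ε z (hf.const_add w)
    have hi2 : Integrable (fun p : E × ℝ ↦ smoothExceed ε z (w + (p.2 * h) • X p.1))
        (P.prod (gaussianReal 0 1)) := integrable_smoothExceed_comp ε z (hg.const_add w)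
    have hi3 : Integrable (fun a ↦ ∫ ξ, smoothExceed ε z (w + (ξ * h) • X a)
      ∂(gaussianReal 0 1)) P := hi2.integral_prod_left
    have hi4 : Integrable (fun a ↦ smoothExceed ε z (w + h • X a)
      - ∫ ξ, smoothExceed ε z (w + (ξ * h) • X a) ∂(gaussianReal 0 1)) P := hi1.sub hi3
    have hfin := abs_integral_le_const (μ := P) fun a ↦ hc (X a) (hXB a) h hh
    rw [integral_sub hi4 hlin, hlin0, sub_zero, integral_sub hi1 hi3] at hfin
    rwa [integral_prod _ hi2]) n 0
  have e := (measurePreserving_arrowProdEquivProdArrow E ℝ (Fin n) (fun _ ↦ P)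
    (fun _ ↦ gaussianReal 0 1)).integral_comp' fun p ↦ smoothExceed ε z (multSum h X p.1 p.2)
  rw [integral_prod _ (integrable_smoothExceed_comp ε z (measurable_multSum_uncurry hX))] at e
  simp only [zero_add] at key
  have e' : ∫ l, smoothExceed ε z (∑ i, ((l i).2 * h) • X (l i).1)
      ∂(Measure.pi fun _ : Fin n ↦ P.prod (gaussianReal 0 1))
      = ∫ l, smoothProb h X ε z l ∂(Measure.pi fun _ : Fin n ↦ P) := e
  rwa [e'] at key

end MultiplierComparison

section GridFamily

variable {E : Type*}

/-- The conditional probability, given the sample, that the maximum of the multiplier sum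
exceeds `z`. -/
def exceedProb {J : Type*} [Fintype J] {n : ℕ} (h : ℝ) (X : E → J → ℝ) (l : Fin n → E)
    (z : ℝ) : ℝ :=
  (gaussPi n).real {ξ | z < ‖multSum h X l ξ‖}

lemma multSum_eq {J : Type*} {n : ℕ} {h : ℝ} {X : E → J → ℝ} (l : Fin n → E) (ξ : Fin n → ℝ) :
    multSum h X l ξ = ∑ i, ξ i • h • X (l i) := by
  simp only [multSum, mul_smul]

section

variable {J : Type*} [Fintype J] {n : ℕ} {h : ℝ} {X : E → J → ℝ}

lemma exceedProb_anti (l : Fin n → E) : Antitone (exceedProb h X l) := fun _ _ hz ↦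
  measureReal_mono fun _ hξ ↦ lt_of_le_of_lt hz hξ

lemma abs_exceedProb_le_one (l : Fin n → E) (z : ℝ) : |exceedProb h X l z| ≤ 1 := by
  rw [exceedProb, abs_of_nonneg measureReal_nonneg]
  exact measureReal_le_one

lemma exceedProb_eq_one (l : Fin n → E) {z : ℝ} (hz : z < 0) : exceedProb h X l z = 1 := by
  have : {ξ : Fin n → ℝ | z < ‖multSum h X l ξ‖} = univ :=
    eq_univ_of_forall fun ξ ↦ hz.trans_le (norm_nonneg _)
  rw [exceedProb, this, probReal_univ]

lemma measurableSet_lt_norm_multSum (l : Fin n → E) (z : ℝ) :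
    MeasurableSet {ξ : Fin n → ℝ | z < ‖multSum h X l ξ‖} :=
  measurableSet_lt measurable_const (measurable_multSum X l).norm

variable [Nonempty J]

lemma exceedProb_le_smoothProb {ε : ℝ} (hℓ : 1 ≤ logCard J) (hε : 0 < ε) (l : Fin n → E) (z : ℝ) :
    exceedProb h X l (z + ε) ≤ smoothProb h X ε z l := by
  rw [exceedProb, ← integral_indicator_one (measurableSet_lt_norm_multSum l _)]
  refine integral_mono_of_nonneg (ae_of_all _ fun ξ ↦ indicator_nonneg (fun _ _ ↦ zero_le_one) ξ)
    (integrable_smoothExceed_comp ε z (measurable_multSum X l)) (ae_of_all _ fun ξ ↦ ?_)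
  beta_reduce
  by_cases hξ : z + ε < ‖multSum h X l ξ‖
  · rw [indicator_of_mem (by exact hξ), smoothExceed_eq_one hℓ hε hξ.le, Pi.one_apply]
  · rw [indicator_of_notMem (by exact hξ)]
    exact smoothExceed_nonneg _ _ _

lemma smoothProb_le_exceedProb {ε : ℝ} (hℓ : 1 ≤ logCard J) (hε : 0 < ε) (l : Fin n → E) (z : ℝ) :
    smoothProb h X ε (z + ε) l ≤ exceedProb h X l z := by
  rw [exceedProb, ← integral_indicator_one (measurableSet_lt_norm_multSum l _)]
  refine integral_mono_of_nonneg (ae_of_all _ fun ξ ↦ smoothExceed_nonneg _ _ _)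
    ((integrable_const 1).indicator (measurableSet_lt_norm_multSum l _))
    (ae_of_all _ fun ξ ↦ ?_)
  beta_reduce
  by_cases hξ : z < ‖multSum h X l ξ‖
  · rw [indicator_of_mem (by exact hξ)]
    exact smoothExceed_le_one _ _ _
  · rw [indicator_of_notMem (by exact hξ), smoothExceed_eq_zero hℓ hε (by linarith [not_lt.1 hξ])]

end

variable [MeasurableSpace E]

lemma measurable_exceedProb {J : Type*} [Fintype J] {n : ℕ} {h : ℝ} {X : E → J → ℝ}
    (hX : Measurable X) (z : ℝ) : Measurable fun l : Fin n → E ↦ exceedProb h X l z := by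
  have hs : MeasurableSet {p : (Fin n → E) × (Fin n → ℝ) | z < ‖multSum h X p.1 p.2‖} :=
    measurableSet_lt measurable_const (measurable_multSum_uncurry hX).norm
  exact (measurable_measure_prodMk_left (ν := gaussPi n) hs).ennreal_toReal

/-- A bounded, centred and normalised process on a grid with `n + 1` points whose paths are
Lipschitz with constant of order `1 / n` between neighbouring points. -/
structure IsGridFamily {n : ℕ} (P : Measure E) (X : E → Fin (n + 1) → ℝ) (B Λ : ℝ) : Prop where
  measurable : Measurable X
  bound : ∀ a j, |X a j| ≤ B
  incr : ∀ a (j : Fin n), |X a j.succ - X a j.castSucc| ≤ Λ / n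
  mean : ∀ j, ∫ a, X a j ∂P = 0
  secondMoment : ∀ j, ∫ a, X a j ^ 2 ∂P = 1

variable {P : Measure E} {n : ℕ} {h B Λ : ℝ} {X : E → Fin (n + 1) → ℝ}

lemma measureReal_le_norm_average_le [IsProbabilityMeasure P] (hn : n * h ^ 2 = 1)
    (hh : 0 ≤ h) (hB : 0 ≤ B) (hΛ : 0 ≤ Λ) (hX : Measurable X) (hXB : ∀ a j, |X a j| ≤ B)
    (hd : ∀ a (j : Fin n), |X a j.succ - X a j.castSucc| ≤ Λ / n)
    (h0 : ∀ j, ∫ a, X a j ∂P = 0) {δ : ℝ} (hδ : 0 < δ) :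
    (Measure.pi fun _ : Fin n ↦ P).real {l | δ ≤ ‖∑ i, h ^ 2 • X (l i)‖} ≤ (B + Λ) * h / δ := by
  have hm : Measurable fun l : Fin n → E ↦ ∑ i, h ^ 2 • X (l i) := by
    exact Finset.measurable_sum _ fun i _ ↦ (hX.const_smul (h ^ 2)).comp (measurable_pi_apply i)
  have hi : Integrable (fun l : Fin n → E ↦ ‖∑ i, h ^ 2 • X (l i)‖)
      (Measure.pi fun _ : Fin n ↦ P) := by
    refine integrable_of_measurable_of_abs_le hm.norm (K := B) fun l ↦ ?_
    rw [abs_norm]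
    calc ‖∑ i, h ^ 2 • X (l i)‖ ≤ ∑ i, ‖h ^ 2 • X (l i)‖ := norm_sum_le _ _
      _ ≤ ∑ _i : Fin n, h ^ 2 * B := by
          refine Finset.sum_le_sum fun i _ ↦ ?_
          rw [norm_smul, norm_pow, Real.norm_of_nonneg hh]
          exact mul_le_mul_of_nonneg_left
            ((pi_norm_le_iff_of_nonneg hB).2 fun j ↦ hXB _ j) (sq_nonneg h)
      _ = n * h ^ 2 * B := by simp; ring
      _ = B := by rw [hn, one_mul]
  have hmk := mul_meas_ge_le_integral_of_nonneg (ae_of_all _ fun _ ↦ norm_nonneg _) hi δ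
  rw [le_div_iff₀ hδ, mul_comm]
  exact hmk.trans (integral_norm_average_le hn hh hB hΛ hX hXB hd h0)

namespace IsGridFamily

lemma measureReal_le_norm_secondMoment_le [IsProbabilityMeasure P] (hX : IsGridFamily P X B Λ)
    (hn : n * h ^ 2 = 1) (hh : 0 ≤ h) (hB : 0 ≤ B) (hΛ : 0 ≤ Λ) {δ : ℝ} (hδ : 0 < δ) :
    (Measure.pi fun _ : Fin n ↦ P).real
        {l | δ ≤ ‖∑ i, h ^ 2 • fun j ↦ (X (l i) j ^ 2 - 1)‖}
      ≤ (B ^ 2 + 1 + 2 * B * Λ) * h / δ := by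
  have hXj : ∀ j, Measurable fun a ↦ X a j := fun j ↦ (measurable_pi_apply j).comp hX.measurable
  have hsq : ∀ a j, X a j ^ 2 ≤ B ^ 2 := fun a j ↦
    sq_le_sq' (neg_le_of_abs_le (hX.bound a j)) (le_of_abs_le (hX.bound a j))
  refine measureReal_le_norm_average_le (X := fun a j ↦ X a j ^ 2 - 1) hn hh (by positivity)
    (by positivity) (measurable_pi_lambda _ fun j ↦ ((hXj j).pow_const 2).sub_const 1)
    (fun a j ↦ ?_) (fun a j ↦ ?_) (fun j ↦ ?_) hδ
  · rw [abs_le]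
    constructor <;> nlinarith [hsq a j, sq_nonneg (X a j)]
  · have e : X a j.succ ^ 2 - 1 - (X a j.castSucc ^ 2 - 1)
        = (X a j.succ + X a j.castSucc) * (X a j.succ - X a j.castSucc) := by ring
    rw [e, abs_mul, mul_div_assoc]
    refine mul_le_mul ((abs_add_le _ _).trans ?_) (hX.incr a j) (abs_nonneg _) (by positivity)
    linarith [hX.bound a j.succ, hX.bound a j.castSucc]
  · rw [integral_sub (integrable_of_measurable_of_abs_le ((hXj j).pow_const 2) (K := B ^ 2)
      fun a ↦ by rw [abs_of_nonneg (sq_nonneg _)]; exact hsq a j) (integrable_const 1),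
      hX.secondMoment]
    simp

lemma integral_norm_multSum_le (hX : IsGridFamily P X B Λ) (hn : n * h ^ 2 = 1) (hB : 0 ≤ B)
    (hΛ : 0 ≤ Λ) (l : Fin n → E) : ∫ ξ, ‖multSum h X l ξ‖ ∂(gaussPi n) ≤ B + Λ :=
  integral_norm_gaussian_multiplier_le hn hB hΛ (fun i j ↦ hX.bound (l i) j)
    fun i j ↦ hX.incr (l i) j

lemma exceedProb_le_div (hX : IsGridFamily P X B Λ) (hn : n * h ^ 2 = 1) (hB : 0 ≤ B)
    (hΛ : 0 ≤ Λ) (l : Fin n → E) {z : ℝ} (hz : 0 < z) : exceedProb h X l z ≤ (B + Λ) / z := by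
  have hi : Integrable (fun ξ ↦ ‖multSum h X l ξ‖) (gaussPi n) := by
    simp only [multSum_eq]
    exact integrable_norm_sum_smul_gaussPi _
  have hmk := mul_meas_ge_le_integral_of_nonneg (ae_of_all _ fun _ ↦ norm_nonneg _) hi z
  rw [le_div_iff₀ hz, mul_comm]
  refine le_trans (mul_le_mul_of_nonneg_left ?_ hz.le)
    (hmk.trans (hX.integral_norm_multSum_le hn hB hΛ l))
  exact measureReal_mono fun ξ (hξ : z < _) ↦ (hξ.le : z ≤ ‖multSum h X l ξ‖)

/-- Conditional anti-concentration of the maximum of the multiplier sum. -/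
lemma exceedProb_sub_le (hX : IsGridFamily P X B Λ) (hn : n * h ^ 2 = 1) (hB : 0 ≤ B)
    (hΛ : 0 ≤ Λ) (l : Fin n → E) {c : ℝ} (hc : c = gaussAbsMoment / 8) (z : ℝ) {r : ℝ}
    (hr : 0 < r) :
    exceedProb h X l (z - r) ≤ exceedProb h X l (z + r) + r * ((B + Λ) / c ^ 2 + 1 / c)
      + {l : Fin n → E | 1 / 2 ≤ ‖∑ i, h ^ 2 • fun j ↦ (X (l i) j ^ 2 - 1)‖}.indicator
        (fun _ ↦ (1 : ℝ)) l := by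
  have hc0 : 0 < c := by rw [hc]; have := gaussAbsMoment_pos; positivity
  by_cases hl : 1 / 2 ≤ ‖∑ i, h ^ 2 • fun j ↦ (X (l i) j ^ 2 - 1)‖
  · rw [indicator_of_mem (by exact hl)]
    have h1 := (abs_le.1 (abs_exceedProb_le_one (h := h) (X := X) l (z - r))).2
    have h2 : 0 ≤ exceedProb h X l (z + r) := measureReal_nonneg
    have h3 : 0 ≤ r * ((B + Λ) / c ^ 2 + 1 / c) := by positivity
    linarith
  rw [indicator_of_notMem (by exact hl), add_zero]
  rw [not_le] at hl
  have hva : ∀ j, (1 / 2 : ℝ) ^ 2 ≤ ∑ i, (h • X (l i)) j ^ 2 := fun j ↦ by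
    have h1 := (norm_le_pi_norm (∑ i, h ^ 2 • fun j ↦ (X (l i) j ^ 2 - 1)) j).trans hl.le
    have e : (∑ i, h ^ 2 • fun j ↦ (X (l i) j ^ 2 - 1)) j
        = ∑ i, (h • X (l i)) j ^ 2 - 1 := by
      simp only [Finset.sum_apply, Pi.smul_apply, smul_eq_mul, mul_sub, Finset.sum_sub_distrib,
        mul_pow, mul_one, Finset.sum_const, Finset.card_univ, Fintype.card_fin, nsmul_eq_mul, hn]
    rw [e, Real.norm_eq_abs] at h1
    have := (abs_le.1 h1).1
    norm_num at this ⊢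
    linarith
  have hK := hX.integral_norm_multSum_le hn hB hΛ l
  simp only [multSum_eq] at hK
  have hac := gaussPi_real_abs_norm_sub_le (fun i ↦ h • X (l i)) (by norm_num) hva hK
    (c := c) (by rw [hc]; ring) z hr
  refine le_trans ?_ (add_le_add le_rfl hac)
  refine le_trans (measureReal_mono fun ξ hξ ↦ ?_) (measureReal_union_le _ _)
  simp only [mem_union, mem_ofPred_eq, multSum_eq] at hξ ⊢
  by_cases h2 : z + r < ‖∑ i, ξ i • h • X (l i)‖
  · exact Or.inl h2
  · refine Or.inr (abs_le.2 ⟨?_, ?_⟩) <;> linarith [not_lt.1 h2]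

end IsGridFamily

end GridFamily

section BootstrapComparison

variable {E : Type*} [MeasurableSpace E] {P : Measure E} [IsProbabilityMeasure P] {n : ℕ}
  {h B Λ : ℝ} {X : E → Fin (n + 1) → ℝ}

/-- The probability that the maximum of the multiplier sum exceeds `z`. -/
def meanExceedProb (P : Measure E) {n : ℕ} (h : ℝ) (X : E → Fin (n + 1) → ℝ) (z : ℝ) : ℝ :=
  ∫ l : Fin n → E, exceedProb h X l z ∂(Measure.pi fun _ : Fin n ↦ P)

lemma integrable_exceedProb (hX : Measurable X) (z : ℝ) :
    Integrable (fun l : Fin n → E ↦ exceedProb h X l z) (Measure.pi fun _ : Fin n ↦ P) :=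
  integrable_of_measurable_of_abs_le (measurable_exceedProb hX z) fun l ↦
    abs_exceedProb_le_one l z

lemma meanExceedProb_anti (hX : Measurable X) : Antitone (meanExceedProb P h X) := fun _ _ hz ↦
  integral_mono (integrable_exceedProb hX _) (integrable_exceedProb hX _) fun l ↦
    exceedProb_anti l hz

lemma meanExceedProb_eq_one {z : ℝ} (hz : z < 0) : meanExceedProb P h X z = 1 := by
  simp only [meanExceedProb, exceedProb_eq_one _ hz]
  simp

lemma meanExceedProb_le_integral_smoothProb {ε : ℝ} (hℓ : 1 ≤ logCard (Fin (n + 1))) (hε : 0 < ε)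
    (hX : Measurable X) (z : ℝ) :
    meanExceedProb P h X (z + ε) ≤ ∫ l, smoothProb h X ε z l ∂(Measure.pi fun _ : Fin n ↦ P) :=
  integral_mono (integrable_exceedProb hX _) (integrable_smoothProb hX ε z) fun l ↦
    exceedProb_le_smoothProb hℓ hε l z

lemma integral_smoothProb_le_meanExceedProb {ε : ℝ} (hℓ : 1 ≤ logCard (Fin (n + 1))) (hε : 0 < ε)
    (hX : Measurable X) (z : ℝ) :
    ∫ l, smoothProb h X ε (z + ε) l ∂(Measure.pi fun _ : Fin n ↦ P) ≤ meanExceedProb P h X z :=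
  integral_mono (integrable_smoothProb hX ε _) (integrable_exceedProb hX _) fun l ↦
    smoothProb_le_exceedProb hℓ hε l z

namespace IsGridFamily

lemma meanExceedProb_le_div (hX : IsGridFamily P X B Λ) (hn : n * h ^ 2 = 1) (hB : 0 ≤ B)
    (hΛ : 0 ≤ Λ) {z : ℝ} (hz : 0 < z) : meanExceedProb P h X z ≤ (B + Λ) / z := by
  refine (integral_mono (integrable_exceedProb hX.measurable _) (integrable_const ((B + Λ) / z))
    fun l ↦ hX.exceedProb_le_div hn hB hΛ l hz).trans ?_
  simp

/-- Anti-concentration of the maximum of the multiplier sum. -/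
lemma meanExceedProb_sub_le (hX : IsGridFamily P X B Λ) (hn : n * h ^ 2 = 1) (hh : 0 ≤ h)
    (hB : 0 ≤ B) (hΛ : 0 ≤ Λ) {c : ℝ} (hc : c = gaussAbsMoment / 8) (z : ℝ) {r : ℝ}
    (hr : 0 < r) :
    meanExceedProb P h X (z - r) ≤ meanExceedProb P h X (z + r)
      + r * ((B + Λ) / c ^ 2 + 1 / c) + 2 * (B ^ 2 + 1 + 2 * B * Λ) * h := by
  set s := {l : Fin n → E | 1 / 2 ≤ ‖∑ i, h ^ 2 • fun j ↦ (X (l i) j ^ 2 - 1)‖} with hs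
  have hXm : Measurable fun a ↦ fun j ↦ (X a j ^ 2 - 1) :=
    measurable_pi_lambda _ fun j ↦
      (((measurable_pi_apply j).comp hX.measurable).pow_const 2).sub_const 1
  have hsm : MeasurableSet s := measurableSet_le measurable_const (Finset.measurable_sum _
    fun i _ ↦ (hXm.const_smul (h ^ 2)).comp (measurable_pi_apply i)).norm
  have hsp := hX.measureReal_le_norm_secondMoment_le hn hh hB hΛ (δ := 1 / 2) (by norm_num)
  have hi := integrable_exceedProb (P := P) (h := h) hX.measurable (z + r)
  have hi2 : Integrable (s.indicator fun _ ↦ (1 : ℝ)) (Measure.pi fun _ : Fin n ↦ P) :=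
    (integrable_const 1).indicator hsm
  have hi1 : Integrable (fun l : Fin n → E ↦ exceedProb h X l (z + r)
      + r * ((B + Λ) / c ^ 2 + 1 / c)) (Measure.pi fun _ : Fin n ↦ P) :=
    hi.add (integrable_const _)
  refine (integral_mono (integrable_exceedProb hX.measurable _) (hi1.add hi2)
    fun l ↦ hX.exceedProb_sub_le hn hB hΛ l hc z hr).trans ?_
  simp only [Pi.add_apply]
  rw [integral_add hi1 hi2, integral_add hi (integrable_const _), integral_indicator_const _ hsm]
  simp only [integral_const, probReal_univ, smul_eq_mul, one_mul, mul_one]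
  have e : (B ^ 2 + 1 + 2 * B * Λ) * h / (1 / 2) = 2 * (B ^ 2 + 1 + 2 * B * Λ) * h := by ring
  rw [e] at hsp
  exact add_le_add le_rfl hsp

/-- The comparison of the law of the maximum of the normalised sum with the one of the maximum of
the multiplier sum. -/
lemma measureReal_lt_norm_sum_le (hX : IsGridFamily P X B Λ) (hn : n * h ^ 2 = 1) (hh : 0 < h)
    {ε : ℝ} (hℓ : 1 ≤ logCard (Fin (n + 1))) (hε : 0 < ε)
    (hεh : ε ^ 4 = logCard (Fin (n + 1)) ^ 2 * h) (z : ℝ) :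
    (Measure.pi fun _ : Fin n ↦ P).real {l | z < ‖∑ i, h • X (l i)‖}
      ≤ meanExceedProb P h X (z - 2 * ε)
        + 13 * smoothBound * (1 + gaussAbsMomentThree) * B ^ 3 * ε := by
  have hm : Measurable fun l : Fin n → E ↦ ∑ i, h • X (l i) :=
    Finset.measurable_sum _ fun i _ ↦ (hX.measurable.const_smul h).comp (measurable_pi_apply i)
  have hs : MeasurableSet {l : Fin n → E | z < ‖∑ i, h • X (l i)‖} :=
    measurableSet_lt measurable_const hm.norm
  have h1 : (Measure.pi fun _ : Fin n ↦ P).real {l | z < ‖∑ i, h • X (l i)‖}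
      ≤ ∫ l, smoothExceed ε (z - ε) (∑ i, h • X (l i)) ∂(Measure.pi fun _ : Fin n ↦ P) := by
    rw [← integral_indicator_one hs]
    refine integral_mono_of_nonneg (ae_of_all _ fun l ↦ indicator_nonneg (fun _ _ ↦ zero_le_one) l)
      (integrable_smoothExceed_comp ε _ hm) (ae_of_all _ fun l ↦ ?_)
    beta_reduce
    by_cases hl : z < ‖∑ i, h • X (l i)‖
    · rw [indicator_of_mem (by exact hl), smoothExceed_eq_one hℓ hε (by linarith), Pi.one_apply]
    · rw [indicator_of_notMem (by exact hl)]
      exact smoothExceed_nonneg _ _ _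
  have h2 := (abs_le.1 (abs_integral_smoothExceed_sum_sub_le (n := n) (z - ε) hℓ hε hh.le hX.measurable
    hX.bound hX.mean)).2
  have h3 := integral_smoothProb_le_meanExceedProb (P := P) (h := h) hℓ hε hX.measurable
    (z - 2 * ε)
  have e1 : z - 2 * ε + ε = z - ε := by ring
  rw [e1] at h3
  have e2 : n * (13 * (smoothBound / logCard (Fin (n + 1))) * (logCard (Fin (n + 1)) / ε * B) ^ 3
      * h ^ 3 * (1 + gaussAbsMomentThree))
      = 13 * smoothBound * (1 + gaussAbsMomentThree) * B ^ 3 * ε := by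
    have hℓ0 : logCard (Fin (n + 1)) ≠ 0 := by positivity
    calc _ = 13 * smoothBound * (1 + gaussAbsMomentThree) * B ^ 3 * (n * h ^ 2)
          * (logCard (Fin (n + 1)) ^ 2 * h) / ε ^ 3 := by field_simp
      _ = _ := by rw [hn, ← hεh]; field_simp
  linarith [e2]

lemma measureReal_exceedProb_lt_le (hX : IsGridFamily P X B Λ) (hn : n * h ^ 2 = 1) (hh : 0 < h)
    {ε : ℝ} (hℓ : 1 ≤ logCard (Fin (n + 1))) (hε : 0 < ε)
    (hεh : ε ^ 4 = logCard (Fin (n + 1)) ^ 2 * h) (hεh3 : h ≤ ε ^ 3) (z : ℝ) :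
    (Measure.pi fun _ : Fin n ↦ P).real
        {l | exceedProb h X l z < meanExceedProb P h X (z + 2 * ε) - ε}
      ≤ 36 * smoothBound ^ 2 * B ^ 4 * ε := by
  have h3 := meanExceedProb_le_integral_smoothProb (P := P) (h := h) hℓ hε hX.measurable (z + ε)
  have e1 : z + ε + ε = z + 2 * ε := by ring
  rw [e1] at h3
  refine (measureReal_mono fun l (hl : exceedProb h X l z < _) ↦ ?_).trans
    ((measureReal_smoothProb_lt_le (z + ε) hℓ hε hX.measurable hX.bound (h := h)).trans ?_)
  · exact (by linarith [smoothProb_le_exceedProb (h := h) (X := X) hℓ hε l z] :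
      smoothProb h X ε (z + ε) l < ∫ l, smoothProb h X ε (z + ε) l ∂(Measure.pi fun _ ↦ P) - ε)
  · have hℓ0 : logCard (Fin (n + 1)) ≠ 0 := by positivity
    calc _ = 36 * smoothBound ^ 2 * B ^ 4 * (n * h ^ 2)
          * (logCard (Fin (n + 1)) ^ 2 * h) * h / ε ^ 6 := by field_simp; ring
      _ = 36 * smoothBound ^ 2 * B ^ 4 * (h / ε ^ 2) := by rw [hn, ← hεh]; field_simp
      _ ≤ _ := by
        refine mul_le_mul_of_nonneg_left ?_ (by positivity)
        rw [div_le_iff₀ (by positivity)]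
        linarith

end IsGridFamily

/-- Comparison of the bootstrap tail with the tail of the normalised sum. -/
theorem exists_bootstrap_threshold (hB : 0 ≤ B) (hΛ : 0 ≤ Λ) {α κ : ℝ} (hα : 0 < α)
    (hκ : 0 ≤ κ) : ∃ C > 0, ∀ n : ℕ, ∀ X : E → Fin (n + 1) → ℝ, IsGridFamily P X B Λ →
      ∀ h ε : ℝ, 0 < h → n * h ^ 2 = 1 → 1 ≤ logCard (Fin (n + 1)) → 0 < ε → h ≤ ε →
      h ≤ ε ^ 3 → ε ^ 4 = logCard (Fin (n + 1)) ^ 2 * h → α + C * ε < 1 →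
      ∃ z₀, 0 ≤ z₀ ∧ z₀ ≤ (B + Λ) / α + 2 ∧
        (Measure.pi fun _ : Fin n ↦ P).real {l | exceedProb h X l (z₀ + κ * ε) < α + 2 * ε}
          ≤ C * ε ∧
        (Measure.pi fun _ : Fin n ↦ P).real {l | z₀ - κ * ε < ‖∑ i, h • X (l i)‖}
          ≤ α + C * ε := by
  set c := gaussAbsMoment / 8 with hc
  have hc0 : 0 < c := by have := gaussAbsMoment_pos; positivity
  have hS := smoothBound_pos
  have hG3 := gaussAbsMomentThree_nonneg
  set G := 13 * smoothBound * (1 + gaussAbsMomentThree) * B ^ 3 with hG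
  have hG0 : 0 ≤ G := by positivity
  set V := 36 * smoothBound ^ 2 * B ^ 4 with hV
  have hV0 : 0 ≤ V := by positivity
  set A := (B + Λ) / c ^ 2 + 1 / c with hA
  have hA0 : 0 ≤ A := by positivity
  set Cb := 2 * (B ^ 2 + 1 + 2 * B * Λ) with hCb
  have hCb0 : 0 ≤ Cb := by positivity
  set D := 1 + (κ + 2) * A + Cb with hD
  have hD0 : 0 ≤ D := by positivity
  refine ⟨2 * D + 2 + G + V, by positivity, fun n X hX h ε hh hn hℓ hε hhε hhε3 hεh hα1 ↦ ?_⟩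
  have hDε := mul_nonneg hD0 hε.le
  have hGε := mul_nonneg hG0 hε.le
  have hVε := mul_nonneg hV0 hε.le
  have hκε := mul_nonneg hκ hε.le
  set a := α + (D + 2) * ε with ha
  have haα : α < a := by linarith
  have ha1 : a < 1 := by linarith
  set M := meanExceedProb P h X with hM
  have hac : ∀ z, M (z - (κ + 2) * ε) ≤ M (z + (κ + 2) * ε) + (D - 1) * ε := fun z ↦ by
    have h1 := hX.meanExceedProb_sub_le hn hh.le hB hΛ hc z (r := (κ + 2) * ε) (by positivity)
    have h2 : Cb * h ≤ Cb * ε := mul_le_mul_of_nonneg_left hhε hCb0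
    have e : (D - 1) * ε = (κ + 2) * ε * A + Cb * ε := by rw [hD]; ring
    rw [e]
    linarith
  set s := {z | M z ≤ a} with hs
  have hbdd : BddBelow s := ⟨0, fun z (hz : M z ≤ a) ↦ by
    by_contra hz0
    rw [hM, meanExceedProb_eq_one (not_le.1 hz0)] at hz
    linarith⟩
  have hKs : (B + Λ) / α + 1 ∈ s := by
    have h1 := hX.meanExceedProb_le_div hn hB hΛ (z := (B + Λ) / α + 1) (by positivity)
    refine (h1.trans ?_ : M _ ≤ a)
    rw [div_le_iff₀ (by positivity)]
    have e : α * ((B + Λ) / α + 1) = B + Λ + α := by field_simp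
    have : α * ((B + Λ) / α + 1) ≤ a * ((B + Λ) / α + 1) :=
      mul_le_mul_of_nonneg_right haα.le (by positivity)
    linarith
  obtain ⟨z₀, hz₀, hlt⟩ : ∃ z ∈ s, z < sInf s + min ε 1 :=
    exists_lt_of_csInf_lt ⟨_, hKs⟩ (by linarith [lt_min hε one_pos])
  have hz₀a : M z₀ ≤ a := hz₀
  have hz₀' : a < M (z₀ - ε) := by
    by_contra hcon
    have := csInf_le hbdd (by exact (not_lt.1 hcon : M (z₀ - ε) ≤ a) : z₀ - ε ∈ s)
    linarith [min_le_left ε 1]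
  have hanti := meanExceedProb_anti (P := P) (h := h) hX.measurable
  refine ⟨z₀, ?_, ?_, ?_, ?_⟩
  · by_contra hcon
    rw [hM, meanExceedProb_eq_one (not_le.1 hcon)] at hz₀a
    linarith
  · linarith [csInf_le hbdd hKs, min_le_right ε 1]
  · have h1 := hX.measureReal_exceedProb_lt_le hn hh hℓ hε hεh hhε3 (z₀ + κ * ε)
    have h2 := hac z₀
    have h3 : M (z₀ - ε) ≤ M (z₀ - (κ + 2) * ε) := hanti (by linarith)
    have e : z₀ + κ * ε + 2 * ε = z₀ + (κ + 2) * ε := by ring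
    rw [e] at h1
    refine (measureReal_mono fun l (hl : exceedProb h X l _ < _) ↦ ?_).trans (h1.trans ?_)
    · refine (hl.trans_le ?_ : exceedProb h X l (z₀ + κ * ε) < M (z₀ + (κ + 2) * ε) - ε)
      linarith
    · linarith
  · have h1 := hX.measureReal_lt_norm_sum_le hn hh hℓ hε hεh (z₀ - κ * ε)
    have h2 := hac z₀
    have h3 : M (z₀ + (κ + 2) * ε) ≤ M z₀ := hanti (by linarith)
    have e : z₀ - κ * ε - 2 * ε = z₀ - (κ + 2) * ε := by ring
    rw [e] at h1
    linarith

end BootstrapComparison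

section Standardised

variable {n : ℕ} {h : ℝ}

/-- The empirical mean of the values at `t`, with weights `h ^ 2`. -/
def weightedMean (h : ℝ) (x : Fin n → ℝ → ℝ) (t : ℝ) : ℝ := ∑ i, h ^ 2 * x i t

/-- The empirical standard deviation of the values at `t`, with weights `h ^ 2`. -/
def weightedSD (h : ℝ) (x : Fin n → ℝ → ℝ) (t : ℝ) : ℝ :=
  Real.sqrt (∑ i, h ^ 2 * x i t ^ 2 - weightedMean h x t ^ 2)

lemma sqrt_cast_eq_inv (hh : 0 < h) (hn : n * h ^ 2 = 1) : Real.sqrt n = h⁻¹ := by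
  have e : (n : ℝ) = h⁻¹ ^ 2 := by rw [inv_pow]; exact eq_inv_of_mul_eq_one_left hn
  rw [e, Real.sqrt_sq (by positivity)]

lemma inv_cast_eq_sq (hn : n * h ^ 2 = 1) : (n : ℝ)⁻¹ = h ^ 2 :=
  inv_eq_of_mul_eq_one_right hn

variable {l : Fin n → C(ℝ, ℝ)} {x : Fin n → ℝ → ℝ} {t m σ : ℝ}

lemma empMean_eq (hn : n * h ^ 2 = 1) (hl : ∀ i, l i t = m + σ * x i t) :
    empMean n l t = m + σ * weightedMean h x t := by
  simp only [empMean, hl, div_eq_mul_inv, inv_cast_eq_sq hn, weightedMean, ← Finset.mul_sum,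
    Finset.sum_add_distrib, Finset.sum_const, Finset.card_univ, Fintype.card_fin, nsmul_eq_mul]
  linear_combination m * hn

lemma empSD_eq (hn : n * h ^ 2 = 1) (hσ : 0 ≤ σ) (hl : ∀ i, l i t = m + σ * x i t) :
    empSD n l t = σ * weightedSD h x t := by
  rw [empSD, empMean_eq hn hl, weightedSD]
  nth_rw 2 [← Real.sqrt_sq hσ]
  rw [← Real.sqrt_mul (sq_nonneg σ)]
  congr 1
  have e : ∀ i, l i t ^ 2 = m ^ 2 + 2 * m * σ * x i t + σ ^ 2 * x i t ^ 2 := fun i ↦ by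
    rw [hl]; ring
  simp only [e, div_eq_mul_inv, inv_cast_eq_sq hn, weightedMean, ← Finset.mul_sum,
    Finset.sum_add_distrib, Finset.sum_const, Finset.card_univ, Fintype.card_fin, nsmul_eq_mul]
  linear_combination m ^ 2 * hn

lemma bootstrap_process_eq (hh : 0 < h) (hn : n * h ^ 2 = 1) (hσ : 0 < σ)
    (hl : ∀ i, l i t = m + σ * x i t) (ξ : Fin n → ℝ) :
    (∑ i, ξ i * (l i t - empMean n l t) / empSD n l t) / Real.sqrt n
      = (∑ i, ξ i * h * x i t - weightedMean h x t * ∑ i, ξ i * h) / weightedSD h x t := by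
  rw [empMean_eq hn hl, empSD_eq hn hσ.le hl, sqrt_cast_eq_inv hh hn, div_inv_eq_mul,
    Finset.sum_mul, Finset.mul_sum, ← Finset.sum_sub_distrib, Finset.sum_div]
  refine Finset.sum_congr rfl fun i _ ↦ ?_
  rw [hl, ← mul_div_mul_left (ξ i * h * x i t - _) _ hσ.ne']
  ring

lemma weightedSD_mem {η : ℝ} (hη : 0 ≤ η) (hη4 : η ≤ 1 / 4) (hm : |weightedMean h x t| ≤ η)
    (hv : |∑ i, h ^ 2 * x i t ^ 2 - 1| ≤ η) :
    1 - 2 * η ≤ weightedSD h x t ∧ weightedSD h x t ≤ 1 + η := by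
  have hm2 : weightedMean h x t ^ 2 ≤ η ^ 2 := sq_le_sq' (neg_le_of_abs_le hm) (le_of_abs_le hm)
  have hv' := abs_le.1 hv
  constructor
  · exact Real.le_sqrt_of_sq_le (by nlinarith)
  · exact Real.sqrt_le_iff.2 ⟨by positivity, by nlinarith [sq_nonneg (weightedMean h x t)]⟩

/-- The grid of `n + 1` equidistant points in `[a, b]`. -/
def gridPoint (a b : ℝ) (n : ℕ) (j : Fin (n + 1)) : ℝ := a + (b - a) * (j / n)

lemma gridPoint_mem {a b : ℝ} (hab : a ≤ b) (j : Fin (n + 1)) : gridPoint a b n j ∈ Icc a b := by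
  have h0 : (0 : ℝ) ≤ (j : ℝ) / n := by positivity
  have h1 : (j : ℝ) / n ≤ 1 := div_le_one_of_le₀ (by exact_mod_cast j.is_le) (by positivity)
  constructor <;> rw [gridPoint] <;> nlinarith

lemma exists_gridPoint {a b : ℝ} (hab : a < b) (hn : 0 < n) {t : ℝ} (ht : t ∈ Icc a b) :
    ∃ j, |t - gridPoint a b n j| ≤ (b - a) / n := by
  have hn' : (0 : ℝ) < n := by exact_mod_cast hn
  have hba : 0 < b - a := sub_pos.2 hab
  set u := (t - a) / (b - a) * n with hu
  have hu0 : 0 ≤ u := mul_nonneg (div_nonneg (sub_nonneg.2 ht.1) hba.le) hn'.le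
  have hun : u ≤ n := mul_le_of_le_one_left hn'.le
    (div_le_one_of_le₀ (by linarith [ht.2]) hba.le)
  have hlt : ⌊u⌋₊ < n + 1 := by
    have := (Nat.floor_mono hun).trans_eq (Nat.floor_natCast n)
    omega
  refine ⟨⟨⌊u⌋₊, hlt⟩, ?_⟩
  have e : t - gridPoint a b n ⟨⌊u⌋₊, hlt⟩ = (b - a) / n * (u - ⌊u⌋₊) := by
    have hua : (b - a) / n * u = t - a := by rw [hu]; field_simp
    rw [gridPoint, mul_sub, hua]
    ring
  rw [e, abs_mul, abs_of_pos (by positivity)]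
  refine mul_le_of_le_one_right (by positivity) (abs_le.2 ⟨?_, ?_⟩)
  · linarith [Nat.floor_le hu0]
  · linarith [Nat.lt_floor_add_one u]

lemma abs_gridPoint_succ_sub (a b : ℝ) (j : Fin n) :
    |gridPoint a b n j.succ - gridPoint a b n j.castSucc| = |b - a| / n := by
  have e : gridPoint a b n j.succ - gridPoint a b n j.castSucc = (b - a) / n := by
    simp only [gridPoint, Fin.val_succ, Fin.val_castSucc]
    push_cast
    ring
  rw [e, abs_div, Nat.abs_cast]

/-- A weighted sum of Lipschitz functions is controlled by its values on the grid. -/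
lemma abs_sum_mul_le_of_grid {a b w L δ : ℝ} (hab : a < b) (hn : 0 < n) (hw : 0 ≤ w)
    (hL : 0 ≤ L) {y : Fin n → ℝ → ℝ}
    (hy : ∀ i, ∀ s ∈ Icc a b, ∀ t ∈ Icc a b, |y i s - y i t| ≤ L * |s - t|)
    (hδ : ∀ j, |∑ i, w * y i (gridPoint a b n j)| ≤ δ) {t : ℝ} (ht : t ∈ Icc a b) :
    |∑ i, w * y i t| ≤ δ + w * (L * (b - a)) := by
  obtain ⟨j, hj⟩ := exists_gridPoint hab hn ht
  have hn' : (0 : ℝ) < n := by exact_mod_cast hn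
  have h1 : |∑ i, w * y i t - ∑ i, w * y i (gridPoint a b n j)| ≤ w * (L * (b - a)) := by
    rw [← Finset.sum_sub_distrib]
    calc |∑ i, (w * y i t - w * y i (gridPoint a b n j))|
        ≤ ∑ i, |w * y i t - w * y i (gridPoint a b n j)| := Finset.abs_sum_le_sum_abs _ _
      _ ≤ ∑ _i : Fin n, w * (L * ((b - a) / n)) := by
          refine Finset.sum_le_sum fun i _ ↦ ?_
          rw [← mul_sub, abs_mul, abs_of_nonneg hw]
          refine mul_le_mul_of_nonneg_left ?_ hw
          exact (hy i t ht _ (gridPoint_mem hab.le j)).trans (mul_le_mul_of_nonneg_left hj hL)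
      _ = w * (L * (b - a)) := by
          rw [Finset.sum_const, Finset.card_univ, Fintype.card_fin, nsmul_eq_mul]
          field_simp
  have h2 := abs_sub_abs_le_abs_sub (∑ i, w * y i t) (∑ i, w * y i (gridPoint a b n j))
  linarith [hδ j]

end Standardised

section Quantile

lemma gaussAbsMoment_le_one : gaussAbsMoment ≤ 1 := by
  have hi : Integrable (fun x : ℝ ↦ x ^ 2) (gaussianReal 0 1) := by
    simpa using integrable_abs_pow_gaussianReal 2
  have h1 : gaussAbsMoment ≤ ∫ x, (1 + x ^ 2) / 2 ∂(gaussianReal 0 1) :=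
    integral_mono integrable_abs_gaussianReal (((integrable_const 1).add hi).div_const 2) fun x ↦ by
      have : |x| ^ 2 = x ^ 2 := sq_abs x
      simp only
      nlinarith [sq_nonneg (|x| - 1)]
  rw [integral_div, integral_add (integrable_const 1) hi, integral_sq_gaussianReal] at h1
  simpa using h1

/-- Functions `l i` which, on `[a, b]`, are obtained by scaling bounded functions `x i` whose
empirical mean is close to `0` and whose empirical second moment is close to `1`. -/
structure IsNearStandard {n : ℕ} (a b h B η : ℝ) (l : Fin n → C(ℝ, ℝ)) (m σ : ℝ → ℝ)
    (x : Fin n → ℝ → ℝ) : Prop where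
  sd_pos : ∀ t ∈ Icc a b, 0 < σ t
  eq : ∀ t ∈ Icc a b, ∀ i, l i t = m t + σ t * x i t
  bound : ∀ t ∈ Icc a b, ∀ i, |x i t| ≤ B
  mean : ∀ t ∈ Icc a b, |weightedMean h x t| ≤ η
  secondMoment : ∀ t ∈ Icc a b, |∑ i, h ^ 2 * x i t ^ 2 - 1| ≤ η

variable {n : ℕ} {a b h B η : ℝ} {l : Fin n → C(ℝ, ℝ)} {m σ : ℝ → ℝ} {x : Fin n → ℝ → ℝ}

namespace IsNearStandard

lemma abs_bootstrap_le (hx : IsNearStandard a b h B η l m σ x) (hh : 0 < h) (hn : n * h ^ 2 = 1)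
    (hB : 0 ≤ B) (hη : 0 ≤ η) (hη4 : η ≤ 1 / 4) {t : ℝ} (ht : t ∈ Icc a b) (ξ : Fin n → ℝ) :
    |(∑ i, ξ i * (l i t - empMean n l t) / empSD n l t) / Real.sqrt n|
      ≤ 2 * (h * (B + 1)) * ∑ i, |ξ i| := by
  rw [bootstrap_process_eq hh hn (hx.sd_pos t ht) (hx.eq t ht)]
  have hv := (weightedSD_mem hη hη4 (hx.mean t ht) (hx.secondMoment t ht)).1
  have hv0 : 0 < weightedSD h x t := by linarith
  rw [abs_div, abs_of_pos hv0, div_le_iff₀ hv0]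
  have h1 : |∑ i, ξ i * h * x i t - weightedMean h x t * ∑ i, ξ i * h|
      ≤ h * (B + 1) * ∑ i, |ξ i| := by
    rw [Finset.mul_sum, ← Finset.sum_sub_distrib, Finset.mul_sum]
    refine (Finset.abs_sum_le_sum_abs _ _).trans (Finset.sum_le_sum fun i _ ↦ ?_)
    have e : ξ i * h * x i t - weightedMean h x t * (ξ i * h)
        = h * (x i t - weightedMean h x t) * ξ i := by ring
    rw [e, abs_mul, abs_mul, abs_of_pos hh]
    refine mul_le_mul_of_nonneg_right (mul_le_mul_of_nonneg_left ?_ hh.le) (abs_nonneg _)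
    exact (abs_sub _ _).trans (by linarith [hx.bound t ht i, hx.mean t ht])
  refine h1.trans ?_
  have h2 : 0 ≤ h * (B + 1) * ∑ i, |ξ i| :=
    mul_nonneg (by positivity) (Finset.sum_nonneg fun i _ ↦ abs_nonneg _)
  nlinarith

lemma abs_sum_le (hx : IsNearStandard a b h B η l m σ x) (hh : 0 < h) (hn : n * h ^ 2 = 1)
    (hη : 0 ≤ η) (hη4 : η ≤ 1 / 4) {t : ℝ} (ht : t ∈ Icc a b) (ξ : Fin n → ℝ) :
    |∑ i, ξ i * h * x i t|
      ≤ (1 + η) * |(∑ i, ξ i * (l i t - empMean n l t) / empSD n l t) / Real.sqrt n|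
        + η * |∑ i, ξ i * h| := by
  rw [bootstrap_process_eq hh hn (hx.sd_pos t ht) (hx.eq t ht)]
  have hv := weightedSD_mem hη hη4 (hx.mean t ht) (hx.secondMoment t ht)
  have hv0 : 0 < weightedSD h x t := by linarith
  set D := (∑ i, ξ i * h * x i t - weightedMean h x t * ∑ i, ξ i * h) / weightedSD h x t with hD
  have e : ∑ i, ξ i * h * x i t = weightedSD h x t * D + weightedMean h x t * ∑ i, ξ i * h := by
    rw [hD, mul_div_cancel₀ _ hv0.ne']
    ring
  rw [e]
  refine (abs_add_le _ _).trans ?_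
  rw [abs_mul, abs_mul, abs_of_pos hv0]
  exact add_le_add (mul_le_mul_of_nonneg_right hv.2 (abs_nonneg _))
    (mul_le_mul_of_nonneg_right (hx.mean t ht) (abs_nonneg _))

/-- A lower bound for the bootstrap quantile. -/
lemma le_adaptQuant (hx : IsNearStandard a b h B η l m σ x) (hab : a ≤ b) (hh : 0 < h)
    (hn : n * h ^ 2 = 1) (hB : 0 ≤ B) (hη : 0 ≤ η) (hη4 : η ≤ 1 / 4) {α q z r : ℝ} (hα : 0 < α)
    (hq : 0 < q) {X : C(ℝ, ℝ) → Fin (n + 1) → ℝ}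
    (hX : ∀ i j, X (l i) j = x i (gridPoint a b n j)) (hz : 0 ≤ z)
    (hr : η * z + η * q⁻¹ ≤ r) (hexc : α + q < exceedProb h X l (z + r)) :
    z ≤ adaptQuant a b α n l := by
  set R : (Fin n → ℝ) → ℝ := fun ξ ↦ ⨆ t : Icc a b,
    |(∑ i, ξ i * (l i ↑t - empMean n l ↑t) / empSD n l ↑t) / Real.sqrt n| with hR
  set K := 2 * (h * (B + 1)) with hK
  have hK0 : 0 ≤ K := by positivity
  have : Nonempty (Icc a b) := ⟨⟨a, left_mem_Icc.2 hab⟩⟩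
  have hbdd : ∀ ξ : Fin n → ℝ, BddAbove (range fun t : Icc a b ↦
      |(∑ i, ξ i * (l i ↑t - empMean n l ↑t) / empSD n l ↑t) / Real.sqrt n|) := fun ξ ↦
    ⟨K * ∑ i, |ξ i|, by
      rintro _ ⟨t, rfl⟩
      exact hx.abs_bootstrap_le hh hn hB hη hη4 t.2 ξ⟩
  have hRle : ∀ ξ, R ξ ≤ K * ∑ i, |ξ i| := fun ξ ↦
    ciSup_le fun t ↦ hx.abs_bootstrap_le hh hn hB hη hη4 t.2 ξ
  refine le_csInf ?_ fun y (hy : gaussPi n {ξ | y < R ξ} ≤ ENNReal.ofReal α) ↦ ?_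
  · have hi : Integrable (fun ξ : Fin n → ℝ ↦ K * ∑ i, |ξ i|) (gaussPi n) :=
      (integrable_finsetSum _ fun i _ ↦
        integrable_comp_eval integrable_abs_gaussianReal).const_mul K
    set I := ∫ ξ : Fin n → ℝ, K * ∑ i, |ξ i| ∂(gaussPi n) with hI
    have hnn : ∀ ξ : Fin n → ℝ, 0 ≤ K * ∑ i, |ξ i| := fun ξ ↦
      mul_nonneg hK0 (Finset.sum_nonneg fun i _ ↦ abs_nonneg _)
    have hI0 : 0 ≤ I := integral_nonneg hnn
    have hmk := mul_meas_ge_le_integral_of_nonneg (ae_of_all _ hnn) hi (I / α + 1)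
    refine ⟨I / α + 1, ?_⟩
    have h1 : (gaussPi n).real {ξ | I / α + 1 < R ξ} ≤ α := by
      refine (measureReal_mono fun ξ (hξ : _ < R ξ) ↦
        (hξ.le.trans (hRle ξ) : I / α + 1 ≤ K * ∑ i, |ξ i|)).trans ?_
      have h2 : (I / α + 1) * α = I + α := by field_simp
      have h3 : 0 < I / α + 1 := by positivity
      refine le_of_mul_le_mul_left (hmk.trans ?_) h3
      linarith
    exact (ENNReal.le_ofReal_iff_toReal_le (measure_ne_top _ _) hα.le).2 h1
  · by_contra hyz
    have hyz' : y < z := not_le.1 hyz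
    have hy' : (gaussPi n).real {ξ | y < R ξ} ≤ α :=
      (ENNReal.le_ofReal_iff_toReal_le (measure_ne_top _ _) hα.le).1 hy
    have hiW : Integrable (fun ξ : Fin n → ℝ ↦ |∑ i, h * ξ i|) (gaussPi n) :=
      (integrable_finsetSum _ fun i _ ↦
        (integrable_comp_eval (X := fun _ : Fin n ↦ ℝ) (μ := fun _ ↦ gaussianReal 0 1) (i := i)
          (f := fun y ↦ y) integrable_id_gaussianReal).const_mul h).abs
    have hW : (gaussPi n).real {ξ | q⁻¹ ≤ |∑ i, h * ξ i|} ≤ q := by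
      have hmk := mul_meas_ge_le_integral_of_nonneg (ae_of_all _ fun ξ ↦ abs_nonneg _) hiW q⁻¹
      rw [integral_abs_sum_mul_gaussPi n fun _ ↦ h] at hmk
      have e : ∑ _i : Fin n, h ^ 2 = 1 := by simp [hn]
      rw [e, Real.sqrt_one, one_mul, inv_mul_le_iff₀ hq] at hmk
      exact hmk.trans (mul_le_of_le_one_right hq.le gaussAbsMoment_le_one)
    have hsub : {ξ : Fin n → ℝ | z + r < ‖multSum h X l ξ‖}
        ⊆ {ξ | y < R ξ} ∪ {ξ | q⁻¹ ≤ |∑ i, h * ξ i|} := fun ξ (hξ : z + r < _) ↦ by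
      by_contra hcon
      simp only [mem_union, mem_ofPred_eq, not_or, not_lt, not_le] at hcon
      have hRz : R ξ ≤ z := hcon.1.trans hyz'.le
      refine absurd hξ (not_lt.2 ((pi_norm_le_iff_of_nonneg ?_).2 fun j ↦ ?_))
      · have : 0 ≤ η * z + η * q⁻¹ := by positivity
        linarith
      · have e : multSum h X l ξ j = ∑ i, ξ i * h * x i (gridPoint a b n j) := by
          simp [multSum, Finset.sum_apply, hX]
        have e2 : ∑ i, ξ i * h = ∑ i, h * ξ i := Finset.sum_congr rfl fun i _ ↦ mul_comm _ _
        rw [e, Real.norm_eq_abs]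
        refine (hx.abs_sum_le hh hn hη hη4 (gridPoint_mem hab j) ξ).trans ?_
        have h1 := (le_ciSup (hbdd ξ) ⟨_, gridPoint_mem hab j⟩).trans hRz
        have h2 := mul_le_mul_of_nonneg_left h1 (by linarith : 0 ≤ 1 + η)
        have h3 := mul_le_mul_of_nonneg_left hcon.2.le hη
        rw [e2]
        linarith
    have := (measureReal_mono (μ := gaussPi n) hsub).trans (measureReal_union_le _ _)
    rw [exceedProb] at hexc
    linarith

/-- Coverage of the mean at one point by the band with half-width factor `Q`. -/
lemma band_covers (hx : IsNearStandard a b h B η l m σ x) (hh : 0 < h)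
    (hn : n * h ^ 2 = 1) (hη : 0 ≤ η) (hη4 : η ≤ 1 / 4) {t z Q : ℝ} (ht : t ∈ Icc a b)
    (hz : 0 ≤ z) (hzQ : z ≤ Q) (hS : |∑ i, h * x i t| ≤ z * (1 - 2 * η)) :
    empMean n l t - Q * empSD n l t / Real.sqrt n ≤ m t ∧
      m t ≤ empMean n l t + Q * empSD n l t / Real.sqrt n := by
  have hσ := hx.sd_pos t ht
  have hv := (weightedSD_mem hη hη4 (hx.mean t ht) (hx.secondMoment t ht)).1
  have h1 : |∑ i, h * x i t| ≤ Q * weightedSD h x t :=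
    hS.trans (mul_le_mul hzQ hv (by linarith) (hz.trans hzQ))
  have e : weightedMean h x t = h * ∑ i, h * x i t := by
    rw [weightedMean, Finset.mul_sum]
    exact Finset.sum_congr rfl fun i _ ↦ by ring
  rw [empMean_eq hn (hx.eq t ht), empSD_eq hn hσ.le (hx.eq t ht), sqrt_cast_eq_inv hh hn,
    div_inv_eq_mul, e]
  have h2 := abs_le.1 h1
  have hσh : 0 ≤ σ t * h := by positivity
  have h3 := mul_le_mul_of_nonneg_left h2.1 hσh
  have h4 := mul_le_mul_of_nonneg_left h2.2 hσh
  constructor <;> linarith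

end IsNearStandard

end Quantile

section Landscape

lemma measurable_eval_const (t : ℝ) : Measurable fun f : C(ℝ, ℝ) ↦ f t :=
  (continuous_eval_const t).measurable

lemma isClosed_isLandscapeType (T : ℝ) : IsClosed {f : C(ℝ, ℝ) | IsLandscapeType T f} := by
  have hc : ∀ t : ℝ, Continuous fun f : C(ℝ, ℝ) ↦ f t := fun t ↦ continuous_eval_const t
  simp only [IsLandscapeType, lipschitzWith_iff_dist_le_mul, ofPred_and, ofPred_forall]
  refine (isClosed_iInter fun s ↦ isClosed_iInter fun t ↦
    isClosed_le ((hc s).dist (hc t)) continuous_const).inter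
      ((isClosed_iInter fun t ↦ (isClosed_le continuous_const (hc t)).inter
        (isClosed_le (hc t) continuous_const)).inter
        (isClosed_iInter fun t ↦ isClosed_iInter fun _ ↦ isClosed_eq (hc t) continuous_const))

lemma IsLandscapeType.abs_sub_le {T : ℝ} {f : ℝ → ℝ} (hf : IsLandscapeType T f) (s t : ℝ) :
    |f s - f t| ≤ |s - t| := by
  simpa [Real.dist_eq] using hf.1.dist_le_mul s t

variable {T : ℝ} {P : Measure C(ℝ, ℝ)} [IsProbabilityMeasure P]

lemma ae_isLandscapeType (hP : P {f | IsLandscapeType T f} = 1) :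
    ∀ᵐ f : C(ℝ, ℝ) ∂P, IsLandscapeType T f :=
  (mem_ae_iff_prob_eq_one (isClosed_isLandscapeType T).measurableSet).2 hP

lemma integrable_eval (hP : P {f | IsLandscapeType T f} = 1) (t : ℝ) :
    Integrable (fun f : C(ℝ, ℝ) ↦ f t) P :=
  Integrable.of_bound (measurable_eval_const t).aestronglyMeasurable (T / 2) <| by
    filter_upwards [ae_isLandscapeType hP] with f hf
    rw [Real.norm_eq_abs, abs_of_nonneg (hf.2.1 t).1]
    exact (hf.2.1 t).2

lemma integrable_sq_eval (hP : P {f | IsLandscapeType T f} = 1) (t : ℝ) :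
    Integrable (fun f : C(ℝ, ℝ) ↦ f t ^ 2) P :=
  Integrable.of_bound ((measurable_eval_const t).pow_const 2).aestronglyMeasurable ((T / 2) ^ 2) <| by
    filter_upwards [ae_isLandscapeType hP] with f hf
    rw [Real.norm_eq_abs, abs_of_nonneg (sq_nonneg _)]
    exact pow_le_pow_left₀ (hf.2.1 t).1 (hf.2.1 t).2 2

lemma abs_integral_sub_integral_le {F G : C(ℝ, ℝ) → ℝ} {K : ℝ} (hF : Integrable F P)
    (hG : Integrable G P) (h : ∀ᵐ f ∂P, |F f - G f| ≤ K) : |∫ f, F f ∂P - ∫ f, G f ∂P| ≤ K := by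
  rw [← integral_sub hF hG]
  simpa using norm_integral_le_of_norm_le_const (μ := P) (f := fun f ↦ F f - G f) h

lemma lmean_mem (hP : P {f | IsLandscapeType T f} = 1) (t : ℝ) :
    0 ≤ lmean P t ∧ lmean P t ≤ T / 2 := by
  constructor
  · refine integral_nonneg_of_ae ?_
    filter_upwards [ae_isLandscapeType hP] with f hf using (hf.2.1 t).1
  · refine (integral_mono_ae (integrable_eval hP t) (integrable_const (T / 2)) ?_).trans (by simp)
    filter_upwards [ae_isLandscapeType hP] with f hf using (hf.2.1 t).2

lemma abs_lmean_sub_le (hP : P {f | IsLandscapeType T f} = 1) (s t : ℝ) :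
    |lmean P s - lmean P t| ≤ |s - t| := by
  refine abs_integral_sub_integral_le (integrable_eval hP s) (integrable_eval hP t) ?_
  filter_upwards [ae_isLandscapeType hP] with f hf using hf.abs_sub_le s t

lemma abs_sq_sub_sq_le {x y M d : ℝ} (hx : 0 ≤ x ∧ x ≤ M / 2) (hy : 0 ≤ y ∧ y ≤ M / 2)
    (hd : |x - y| ≤ d) : |x ^ 2 - y ^ 2| ≤ M * d := by
  have e : x ^ 2 - y ^ 2 = (x + y) * (x - y) := by ring
  rw [e, abs_mul, abs_of_nonneg (by linarith)]
  exact mul_le_mul (by linarith) hd (abs_nonneg _) (by linarith)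

lemma abs_lvar_sub_le (hP : P {f | IsLandscapeType T f} = 1) (s t : ℝ) :
    |lvar P s - lvar P t| ≤ 2 * T * |s - t| := by
  have h1 : |∫ f, f s ^ 2 ∂P - ∫ f, f t ^ 2 ∂P| ≤ T * |s - t| := by
    refine abs_integral_sub_integral_le (integrable_sq_eval hP s) (integrable_sq_eval hP t) ?_
    filter_upwards [ae_isLandscapeType hP] with f hf
    exact abs_sq_sub_sq_le (hf.2.1 s) (hf.2.1 t) (hf.abs_sub_le s t)
  have h2 := abs_sq_sub_sq_le (lmean_mem hP s) (lmean_mem hP t) (abs_lmean_sub_le hP s t)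
  have e : lvar P s - lvar P t = (∫ f, f s ^ 2 ∂P - ∫ f, f t ^ 2 ∂P)
      - (lmean P s ^ 2 - lmean P t ^ 2) := by rw [lvar, lvar]; ring
  rw [e]
  exact (abs_sub _ _).trans (by linarith)

lemma lsd_sq {P : Measure C(ℝ, ℝ)} {c t : ℝ} (hc : 0 < c) (hσ : c ≤ lsd P t) : lsd P t ^ 2 = lvar P t :=
  Real.sq_sqrt (Real.sqrt_pos.1 (hc.trans_le hσ)).le

lemma abs_lsd_sub_le (hP : P {f | IsLandscapeType T f} = 1) {c s t : ℝ} (hc : 0 < c)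
    (hs : c ≤ lsd P s) (ht : c ≤ lsd P t) : |lsd P s - lsd P t| ≤ T / c * |s - t| := by
  have h1 := abs_lvar_sub_le hP s t
  have e : lvar P s - lvar P t = (lsd P s + lsd P t) * (lsd P s - lsd P t) := by
    rw [← lsd_sq hc hs, ← lsd_sq hc ht]; ring
  rw [e, abs_mul, abs_of_pos (by linarith)] at h1
  rw [div_mul_eq_mul_div, le_div_iff₀ hc]
  nlinarith [abs_nonneg (lsd P s - lsd P t)]

open Classical in
/-- The standardised value at `t` of a landscape-type function (and `0` for other functions). -/
def standardise (T : ℝ) (P : Measure C(ℝ, ℝ)) (f : C(ℝ, ℝ)) (t : ℝ) : ℝ :=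
  if IsLandscapeType T f then (f t - lmean P t) / lsd P t else 0

lemma standardise_of_isLandscapeType {P : Measure C(ℝ, ℝ)} {f : C(ℝ, ℝ)} (hf : IsLandscapeType T f) (t : ℝ) :
    standardise T P f t = (f t - lmean P t) / lsd P t := if_pos hf

lemma standardise_of_not {P : Measure C(ℝ, ℝ)} {f : C(ℝ, ℝ)} (hf : ¬ IsLandscapeType T f) (t : ℝ) :
    standardise T P f t = 0 := if_neg hf

lemma measurable_standardise {P : Measure C(ℝ, ℝ)} (t : ℝ) : Measurable fun f ↦ standardise T P f t :=
  Measurable.ite (isClosed_isLandscapeType T).measurableSet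
    (((measurable_eval_const t).sub_const _).div_const _) measurable_const

lemma abs_standardise_le (hT : 0 < T) (hP : P {f | IsLandscapeType T f} = 1) {c t : ℝ} (hc : 0 < c)
    (hσ : c ≤ lsd P t) (f : C(ℝ, ℝ)) : |standardise T P f t| ≤ T / (2 * c) := by
  by_cases hf : IsLandscapeType T f
  · rw [standardise_of_isLandscapeType hf, abs_div, abs_of_pos (hc.trans_le hσ), ← div_div]
    refine div_le_div₀ (by positivity) (abs_le.2 ?_) hc hσ
    constructor <;> linarith [hf.2.1 t, lmean_mem hP t]
  · rw [standardise_of_not hf, abs_zero]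
    positivity

lemma abs_standardise_sub_le (hT : 0 < T) (hP : P {f | IsLandscapeType T f} = 1) {c s t : ℝ}
    (hc : 0 < c) (hs : c ≤ lsd P s) (ht : c ≤ lsd P t) (f : C(ℝ, ℝ)) :
    |standardise T P f s - standardise T P f t| ≤ (2 / c + T ^ 2 / (2 * c ^ 3)) * |s - t| := by
  by_cases hf : IsLandscapeType T f
  swap
  · rw [standardise_of_not hf, standardise_of_not hf, sub_self, abs_zero]
    positivity
  have hb := abs_standardise_le hT hP hc ht f
  rw [standardise_of_isLandscapeType hf] at hb
  rw [standardise_of_isLandscapeType hf, standardise_of_isLandscapeType hf]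
  have hs0 : 0 < lsd P s := hc.trans_le hs
  have ht0 : 0 < lsd P t := hc.trans_le ht
  have e : (f s - lmean P s) / lsd P s - (f t - lmean P t) / lsd P t
      = (((f s - f t) - (lmean P s - lmean P t))
        - (f t - lmean P t) / lsd P t * (lsd P s - lsd P t)) / lsd P s := by
    field_simp
    ring
  rw [e, abs_div, abs_of_pos hs0]
  have h1 : |((f s - f t) - (lmean P s - lmean P t))
        - (f t - lmean P t) / lsd P t * (lsd P s - lsd P t)|
      ≤ (2 + T / (2 * c) * (T / c)) * |s - t| := by
    refine (abs_sub _ _).trans ?_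
    have h2 := (abs_sub (f s - f t) (lmean P s - lmean P t)).trans
      (add_le_add (hf.abs_sub_le s t) (abs_lmean_sub_le hP s t))
    have h3 := mul_le_mul hb (abs_lsd_sub_le hP hc hs ht) (abs_nonneg _) (by positivity)
    rw [abs_mul]
    linarith
  refine (div_le_div₀ (by positivity) h1 hc hs).trans (le_of_eq ?_)
  field_simp

lemma integral_standardise (hP : P {f | IsLandscapeType T f} = 1) (t : ℝ) :
    ∫ f, standardise T P f t ∂P = 0 := by
  have h1 : ∫ f, standardise T P f t ∂P = ∫ f, (f t - lmean P t) / lsd P t ∂P :=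
    integral_congr_ae <| by
      filter_upwards [ae_isLandscapeType hP] with f hf using standardise_of_isLandscapeType hf t
  rw [h1, integral_div, integral_sub (integrable_eval hP t) (integrable_const _)]
  simp [lmean]

lemma integral_standardise_sq (hP : P {f | IsLandscapeType T f} = 1) {c t : ℝ} (hc : 0 < c)
    (hσ : c ≤ lsd P t) : ∫ f, standardise T P f t ^ 2 ∂P = 1 := by
  have h1 : ∫ f, standardise T P f t ^ 2 ∂P
      = ∫ f, (f t ^ 2 - 2 * lmean P t * f t + lmean P t ^ 2) / lsd P t ^ 2 ∂P :=
    integral_congr_ae <| by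
      filter_upwards [ae_isLandscapeType hP] with f hf
      rw [standardise_of_isLandscapeType hf t]
      ring
  have hi1 := integrable_sq_eval hP t
  have hi2 := (integrable_eval hP t).const_mul (2 * lmean P t)
  have hi3 : Integrable (fun f : C(ℝ, ℝ) ↦ f t ^ 2 - 2 * lmean P t * f t) P := hi1.sub hi2
  have hpos : lsd P t ≠ 0 := (hc.trans_le hσ).ne'
  rw [h1, integral_div, integral_add hi3 (integrable_const _), integral_sub hi1 hi2,
    integral_const_mul, div_eq_one_iff_eq (pow_ne_zero 2 hpos), lsd_sq hc hσ, lvar]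
  simp only [integral_const, probReal_univ, one_smul]
  rw [← lmean]
  ring

lemma isGridFamily_standardise (hT : 0 < T) (hP : P {f | IsLandscapeType T f} = 1)
    {t₁ t₂ c : ℝ} (h₁₂ : t₁ ≤ t₂) (hc : 0 < c) (hσ : ∀ t ∈ Icc t₁ t₂, c ≤ lsd P t) (n : ℕ) :
    IsGridFamily P (fun f j ↦ standardise T P f (gridPoint t₁ t₂ n j)) (T / (2 * c))
      ((2 / c + T ^ 2 / (2 * c ^ 3)) * (t₂ - t₁)) where
  measurable := measurable_pi_lambda _ fun _ ↦ measurable_standardise _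
  bound f j := abs_standardise_le hT hP hc (hσ _ (gridPoint_mem h₁₂ j)) f
  incr f j := by
    refine (abs_standardise_sub_le hT hP hc (hσ _ (gridPoint_mem h₁₂ _))
      (hσ _ (gridPoint_mem h₁₂ _)) f).trans (le_of_eq ?_)
    rw [abs_gridPoint_succ_sub, abs_of_nonneg (sub_nonneg.2 h₁₂), mul_div_assoc]
  mean j := integral_standardise hP _
  secondMoment j := integral_standardise_sq hP hc (hσ _ (gridPoint_mem h₁₂ j))

end Landscape

section Coverage

variable {T : ℝ} {P : Measure C(ℝ, ℝ)} [IsProbabilityMeasure P] {t₁ t₂ c : ℝ}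

lemma ae_pi_isLandscapeType (hP : P {f | IsLandscapeType T f} = 1) (n : ℕ) :
    ∀ᵐ l : Fin n → C(ℝ, ℝ) ∂(Measure.pi fun _ : Fin n ↦ P), ∀ i, IsLandscapeType T (l i) :=
  ae_all_iff.2 fun i ↦ (Measure.tendsto_eval_ae_ae (α := fun _ : Fin n ↦ C(ℝ, ℝ))
    (μ := fun _ ↦ P) (i := i)).eventually (ae_isLandscapeType hP)

/-- If the grid averages of the standardised functions and of their squares are close to `0` and
`1`, then the sample is nearly standardised on the whole interval. -/
lemma isNearStandard_of_grid (hT : 0 < T) (hP : P {f | IsLandscapeType T f} = 1) (h₁₂ : t₁ < t₂)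
    (hc : 0 < c) (hσ : ∀ t ∈ Icc t₁ t₂, c ≤ lsd P t) {n : ℕ} (hn0 : 0 < n) {h B L δ η : ℝ}
    (hn : n * h ^ 2 = 1) (hB : B = T / (2 * c)) (hL : L = 2 / c + T ^ 2 / (2 * c ^ 3))
    (hη1 : δ + h ^ 2 * (L * (t₂ - t₁)) ≤ η) (hη2 : δ + h ^ 2 * (2 * B * L * (t₂ - t₁)) ≤ η)
    {l : Fin n → C(ℝ, ℝ)} (hl : ∀ i, IsLandscapeType T (l i))
    (hmean : ∀ j, |∑ i, h ^ 2 * standardise T P (l i) (gridPoint t₁ t₂ n j)| ≤ δ)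
    (hsq : ∀ j, |∑ i, h ^ 2 * (standardise T P (l i) (gridPoint t₁ t₂ n j) ^ 2 - 1)| ≤ δ) :
    IsNearStandard t₁ t₂ h B η l (lmean P) (lsd P) fun i t ↦ standardise T P (l i) t := by
  have hB0 : 0 ≤ B := by rw [hB]; positivity
  have hL0 : 0 ≤ L := by rw [hL]; positivity
  have hb : ∀ t ∈ Icc t₁ t₂, ∀ i, |standardise T P (l i) t| ≤ B := fun t ht i ↦
    hB ▸ abs_standardise_le hT hP hc (hσ t ht) (l i)
  have hlip : ∀ i, ∀ s ∈ Icc t₁ t₂, ∀ t ∈ Icc t₁ t₂,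
      |standardise T P (l i) s - standardise T P (l i) t| ≤ L * |s - t| := fun i s hs t ht ↦
    hL ▸ abs_standardise_sub_le hT hP hc (hσ s hs) (hσ t ht) (l i)
  refine ⟨fun t ht ↦ hc.trans_le (hσ t ht), fun t ht i ↦ ?_, hb, fun t ht ↦ ?_, fun t ht ↦ ?_⟩
  · have := (hc.trans_le (hσ t ht)).ne'
    rw [standardise_of_isLandscapeType (hl i)]
    field_simp
    ring
  · exact (abs_sum_mul_le_of_grid h₁₂ hn0 (sq_nonneg h) hL0 hlip hmean ht).trans hη1
  · have hlip2 : ∀ i, ∀ s ∈ Icc t₁ t₂, ∀ t ∈ Icc t₁ t₂,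
        |(standardise T P (l i) s ^ 2 - 1) - (standardise T P (l i) t ^ 2 - 1)|
          ≤ 2 * B * L * |s - t| := fun i s hs t ht ↦ by
      have e : (standardise T P (l i) s ^ 2 - 1) - (standardise T P (l i) t ^ 2 - 1)
          = (standardise T P (l i) s + standardise T P (l i) t)
            * (standardise T P (l i) s - standardise T P (l i) t) := by ring
      rw [e, abs_mul, mul_assoc]
      refine mul_le_mul ((abs_add_le _ _).trans ?_) (hlip i s hs t ht) (abs_nonneg _)
        (by positivity)
      linarith [hb s hs i, hb t ht i]
    have h1 := abs_sum_mul_le_of_grid (y := fun i t ↦ standardise T P (l i) t ^ 2 - 1) h₁₂ hn0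
      (sq_nonneg h) (by positivity) hlip2 hsq ht
    have e : ∑ i, h ^ 2 * (standardise T P (l i) t ^ 2 - 1)
        = ∑ i, h ^ 2 * standardise T P (l i) t ^ 2 - 1 := by
      simp only [mul_sub, Finset.sum_sub_distrib, mul_one, Finset.sum_const, Finset.card_univ,
        Fintype.card_fin, nsmul_eq_mul, hn]
    rw [e] at h1
    exact h1.trans hη2

/-- The event that the adaptive band covers the mean function. -/
def coverEvent (P : Measure C(ℝ, ℝ)) (t₁ t₂ α : ℝ) (n : ℕ) : Set (Fin n → C(ℝ, ℝ)) :=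
  {l | ∀ t ∈ Icc t₁ t₂,
    empMean n l t - adaptQuant t₁ t₂ α n l * empSD n l t / Real.sqrt n ≤ lmean P t ∧
    lmean P t ≤ empMean n l t + adaptQuant t₁ t₂ α n l * empSD n l t / Real.sqrt n}

lemma exists_coverage_bound (hT : 0 < T) (hP : P {f | IsLandscapeType T f} = 1) (h₁₂ : t₁ < t₂)
    (hc : 0 < c) (hσ : ∀ t ∈ Icc t₁ t₂, c ≤ lsd P t) {α : ℝ} (hα : 0 < α) :
    ∃ C > 0, ∀ n : ℕ, 0 < n → ∀ h q ε : ℝ, n * h ^ 2 = 1 → 0 < q → q ≤ 1 → q ^ 4 = h →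
      1 ≤ logCard (Fin (n + 1)) → 0 < ε → ε ^ 2 = logCard (Fin (n + 1)) * q ^ 2 →
      1 - α - C * ε ≤ (Measure.pi fun _ : Fin n ↦ P).real (coverEvent P t₁ t₂ α n) := by
  set B := T / (2 * c) with hB
  set L := 2 / c + T ^ 2 / (2 * c ^ 3) with hL
  have hB0 : 0 ≤ B := by positivity
  have hL0 : 0 ≤ L := by positivity
  have hba : 0 < t₂ - t₁ := sub_pos.2 h₁₂
  set Λ := L * (t₂ - t₁) with hΛ
  have hΛ0 : 0 ≤ Λ := by positivity
  set Z := (B + Λ) / α + 2 with hZ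
  have hZ0 : 0 ≤ Z := by positivity
  set e := 1 + Λ + 2 * B * Λ with he
  have hBΛ : 0 ≤ B * Λ := mul_nonneg hB0 hΛ0
  have he0 : 0 ≤ e := by positivity
  set κ := e * (2 * Z + 1) + Λ with hκ
  have hκ0 : 0 ≤ κ := by positivity
  obtain ⟨C₀, hC₀, hcore⟩ := exists_bootstrap_threshold (P := P) hB0 hΛ0 hα hκ0
  set C₁ := B + Λ with hC₁
  set C₂ := B ^ 2 + 1 + 2 * B * Λ with hC₂
  have hC₁0 : 0 ≤ C₁ := by positivity
  have hC₂0 : 0 ≤ C₂ := by positivity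
  refine ⟨2 * C₀ + C₁ + C₂ + 4 * e, by positivity, fun n hn0 h q ε hn hq hq1 hqh hℓ hε hεq ↦ ?_⟩
  have hC₀ε := mul_nonneg hC₀.le hε.le
  have hC₁ε := mul_nonneg hC₁0 hε.le
  have hC₂ε := mul_nonneg hC₂0 hε.le
  have heε := mul_nonneg he0 hε.le
  by_cases hsmall : 1 - α - (2 * C₀ + C₁ + C₂ + 4 * e) * ε ≤ 0
  · exact hsmall.trans measureReal_nonneg
  rw [not_le] at hsmall
  have hh : 0 < h := by rw [← hqh]; positivity
  have hqε : q ≤ ε := by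
    refine le_of_sq_le_sq ?_ hε.le
    rw [hεq]
    exact le_mul_of_one_le_left (sq_nonneg q) hℓ
  have hhq2 : h ≤ q ^ 2 := by rw [← hqh]; exact pow_le_pow_of_le_one hq.le hq1 (by norm_num)
  have hhq3 : h ≤ q ^ 3 := by rw [← hqh]; exact pow_le_pow_of_le_one hq.le hq1 (by norm_num)
  have hq2q : q ^ 2 ≤ q := by
    exact pow_le_of_le_one hq.le hq1 two_ne_zero
  have hhε : h ≤ ε := by linarith
  have hh1 : h ≤ 1 := by linarith
  have hh2 : h ^ 2 ≤ q ^ 2 := (pow_le_of_le_one hh.le hh1 two_ne_zero).trans hhq2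
  have hhε3 : h ≤ ε ^ 3 := hhq3.trans (pow_le_pow_left₀ hq.le hqε 3)
  have hεh : ε ^ 4 = logCard (Fin (n + 1)) ^ 2 * h := by
    rw [← hqh]
    linear_combination (ε ^ 2 + logCard (Fin (n + 1)) * q ^ 2) * hεq
  have hX := isGridFamily_standardise hT hP h₁₂.le hc hσ n
  set X : C(ℝ, ℝ) → Fin (n + 1) → ℝ := fun f j ↦ standardise T P f (gridPoint t₁ t₂ n j) with hXdef
  obtain ⟨z₀, hz₀, hz₀Z, hA3, hA4⟩ := hcore n X hX h ε hh hn hℓ hε hhε hhε3 hεh (by linarith)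
  set μ := Measure.pi fun _ : Fin n ↦ P with hμ
  set N := {l : Fin n → C(ℝ, ℝ) | ¬ ∀ i, IsLandscapeType T (l i)} with hN
  set A1 := {l : Fin n → C(ℝ, ℝ) | q ^ 2 ≤ ‖∑ i, h ^ 2 • X (l i)‖} with hA1def
  set A2 := {l : Fin n → C(ℝ, ℝ) | q ^ 2 ≤ ‖∑ i, h ^ 2 • fun j ↦ (X (l i) j ^ 2 - 1)‖} with hA2def
  set A3 := {l : Fin n → C(ℝ, ℝ) | exceedProb h X l (z₀ + κ * ε) < α + 2 * ε} with hA3def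
  set A4 := {l : Fin n → C(ℝ, ℝ) | z₀ - κ * ε < ‖∑ i, h • X (l i)‖} with hA4def
  have hN0 : μ.real N = 0 := by
    rw [measureReal_def, (ae_iff.1 (ae_pi_isLandscapeType hP n) : μ N = 0), ENNReal.toReal_zero]
  have hhdiv : h / q ^ 2 ≤ ε := by
    rw [div_le_iff₀ (by positivity)]
    calc h ≤ q * q ^ 2 := by rw [← pow_succ']; exact hhq3
      _ ≤ ε * q ^ 2 := mul_le_mul_of_nonneg_right hqε (sq_nonneg q)
  have hA1 : μ.real A1 ≤ C₁ * ε := by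
    refine (measureReal_le_norm_average_le hn hh.le hB0 hΛ0 hX.measurable hX.bound hX.incr hX.mean
      (by positivity)).trans ?_
    rw [mul_div_assoc]
    exact mul_le_mul_of_nonneg_left hhdiv hC₁0
  have hA2 : μ.real A2 ≤ C₂ * ε := by
    refine (hX.measureReal_le_norm_secondMoment_le hn hh.le hB0 hΛ0 (by positivity)).trans ?_
    rw [mul_div_assoc]
    exact mul_le_mul_of_nonneg_left hhdiv hC₂0
  have hsub : (coverEvent P t₁ t₂ α n)ᶜ ⊆ N ∪ A1 ∪ A2 ∪ A3 ∪ A4 := by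
    intro l hl
    by_contra hcon
    simp only [mem_union, not_or, hN, hA1def, hA2def, hA3def, hA4def, mem_ofPred_eq, not_not,
      not_lt, not_le] at hcon
    obtain ⟨⟨⟨⟨hland, hl1⟩, hl2⟩, hl3⟩, hl4⟩ := hcon
    refine hl fun t ht ↦ ?_
    set η := e * q ^ 2 with hη
    have hη0 : 0 ≤ η := by positivity
    have hηε : η ≤ e * ε := mul_le_mul_of_nonneg_left (hq2q.trans hqε) he0
    have hη4 : η ≤ 1 / 4 := by linarith
    have hmesh : ∀ {u : ℝ}, 0 ≤ u → h ^ 2 * u ≤ q ^ 2 * u := fun hu ↦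
      mul_le_mul_of_nonneg_right hh2 hu
    have hq20 := sq_nonneg q
    have hns := isNearStandard_of_grid hT hP h₁₂ hc hσ hn0 hn hB hL (δ := q ^ 2) (η := η)
      (by
        have h1 := hmesh hΛ0
        have h2 := mul_nonneg hq20 hBΛ
        rw [hη, he]
        linarith)
      (by
        have h1 := hmesh hBΛ
        have h2 := mul_nonneg hq20 hΛ0
        have h3 : 2 * B * L * (t₂ - t₁) = 2 * (B * Λ) := by rw [hΛ]; ring
        rw [hη, he, h3]
        linarith)
      hland
      (fun j ↦ by
        have h1 := (norm_le_pi_norm (∑ i, h ^ 2 • X (l i)) j).trans hl1.le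
        simpa [Finset.sum_apply, hXdef] using h1)
      (fun j ↦ by
        have h1 := (norm_le_pi_norm (∑ i, h ^ 2 • fun j ↦ (X (l i) j ^ 2 - 1)) j).trans hl2.le
        simpa [Finset.sum_apply, hXdef] using h1)
    have hηz : η * z₀ ≤ e * Z * ε := by
      calc η * z₀ ≤ (e * ε) * Z := mul_le_mul hηε hz₀Z hz₀ heε
        _ = e * Z * ε := by ring
    have heZε : 0 ≤ e * Z * ε := by positivity
    have hΛε := mul_nonneg hΛ0 hε.le
    have hΛh := mul_le_mul_of_nonneg_left hhε hΛ0
    have hκε : κ * ε = 2 * (e * Z * ε) + e * ε + Λ * ε := by rw [hκ]; ring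
    have hQ : z₀ ≤ adaptQuant t₁ t₂ α n l := by
      refine hns.le_adaptQuant h₁₂.le hh hn hB0 hη0 hη4 hα hq (X := X) (fun i j ↦ rfl) hz₀ ?_
        (r := κ * ε) (by linarith)
      have h1 : η * q⁻¹ = e * q := by rw [hη]; field_simp
      have h2 := mul_le_mul_of_nonneg_left hqε he0
      rw [h1]
      linarith
    refine hns.band_covers hh hn hη0 hη4 ht hz₀ hQ ?_
    refine (abs_sum_mul_le_of_grid h₁₂ hn0 hh.le hL0 (δ := z₀ - κ * ε)
      (fun i s hs t ht ↦ abs_standardise_sub_le hT hP hc (hσ s hs) (hσ t ht) (l i))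
      (fun j ↦ ?_) ht).trans ?_
    · have h1 := (norm_le_pi_norm (∑ i, h • X (l i)) j).trans hl4
      simpa [Finset.sum_apply, hXdef] using h1
    · rw [← hΛ]
      linarith
  have h1 : 1 ≤ μ.real (coverEvent P t₁ t₂ α n) + μ.real (coverEvent P t₁ t₂ α n)ᶜ := by
    rw [← probReal_univ (μ := μ), ← union_compl_self (coverEvent P t₁ t₂ α n)]
    exact measureReal_union_le _ _
  have h2 : μ.real (coverEvent P t₁ t₂ α n)ᶜ
      ≤ μ.real N + μ.real A1 + μ.real A2 + μ.real A3 + μ.real A4 :=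
    (measureReal_mono hsub).trans <| (measureReal_union_le _ _).trans <| add_le_add
      ((measureReal_union_le _ _).trans <| add_le_add ((measureReal_union_le _ _).trans <|
        add_le_add (measureReal_union_le _ _) le_rfl) le_rfl) le_rfl
  linarith

lemma logCard_fin_mem {n : ℕ} (hn : 2 ≤ n) :
    1 ≤ logCard (Fin (n + 1)) ∧ logCard (Fin (n + 1)) ≤ 3 * Real.log n := by
  have hn' : (2 : ℝ) ≤ n := by exact_mod_cast hn
  rw [logCard, Fintype.card_fin]
  push_cast
  constructor
  · rw [Real.le_log_iff_exp_le (by positivity)]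
    linarith [Real.exp_one_lt_d9]
  · have e : 3 * Real.log n = Real.log ((n : ℝ) ^ 3) := by rw [Real.log_pow]; norm_num
    rw [e]
    refine Real.log_le_log (by positivity) ?_
    nlinarith [mul_le_mul hn' hn' (by norm_num) (by positivity)]

end Coverage

/-- **Adaptive confidence band: coverage.**  If `P` is concentrated on landscape-type
functions and `σ(t) ≥ c > 0` on `[t₁,t₂] ⊆ [0,T]`, then for every `α ∈ (0,1)` there are
`C > 0` and `N₀` such that for all `n ≥ N₀`,
`Pⁿ(∀ t ∈ [t₁,t₂], λ̄_n(t) − Q̂_α σ̂_n(t)/√n ≤ μ(t) ≤ λ̄_n(t) + Q̂_α σ̂_n(t)/√n)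
  ≥ 1 − α − C (log n)^{1/2} n^{−1/8}`. -/
theorem adaptive_band_coverage (T : ℝ) (hT : 0 < T)
    (P : Measure C(ℝ, ℝ)) [IsProbabilityMeasure P]
    (hP : P {f | IsLandscapeType T f} = 1)
    (t₁ t₂ c : ℝ) (ht₁ : 0 ≤ t₁) (h₁₂ : t₁ < t₂) (ht₂ : t₂ ≤ T) (hc : 0 < c)
    (hσ : ∀ t ∈ Icc t₁ t₂, c ≤ lsd P t)
    (α : ℝ) (hα0 : 0 < α) (hα1 : α < 1) :
    ∃ C > (0 : ℝ), ∃ N₀ : ℕ, ∀ n ≥ N₀,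
      ENNReal.ofReal (1 - α - C * Real.log n ^ ((1 : ℝ) / 2) / (n : ℝ) ^ ((1 : ℝ) / 8))
        ≤ (Measure.pi fun _ : Fin n => P)
            {l | ∀ t ∈ Icc t₁ t₂,
                empMean n l t - adaptQuant t₁ t₂ α n l * empSD n l t / Real.sqrt n
                    ≤ lmean P t ∧
                lmean P t
                    ≤ empMean n l t + adaptQuant t₁ t₂ α n l * empSD n l t / Real.sqrt n} := by
  obtain ⟨C, hC, hcov⟩ := exists_coverage_bound hT hP h₁₂ hc hσ hα0
  refine ⟨2 * C, by positivity, 2, fun n hn ↦ ?_⟩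
  have hn' : (2 : ℝ) ≤ n := by exact_mod_cast hn
  obtain ⟨hℓ1, hℓ3⟩ := logCard_fin_mem hn
  set ℓ := logCard (Fin (n + 1)) with hℓ
  set r := (n : ℝ) ^ ((1 : ℝ) / 8) with hr
  have hr1 : 1 ≤ r := Real.one_le_rpow (by linarith) (by norm_num)
  have hr8 : r ^ 8 = n := by
    rw [hr, ← Real.rpow_natCast, ← Real.rpow_mul (by positivity)]
    norm_num
  have hr0 : 0 < r := by linarith
  have hb := hcov n (by omega) (r⁻¹ ^ 4) r⁻¹ (Real.sqrt ℓ * r⁻¹)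
    (by rw [← hr8]; field_simp) (by positivity) (inv_le_one_of_one_le₀ hr1) rfl hℓ1
    (mul_pos (Real.sqrt_pos.2 (by linarith)) (by positivity))
    (by rw [mul_pow, Real.sq_sqrt (by linarith)])
  have hsq : Real.sqrt ℓ ≤ 2 * Real.log n ^ ((1 : ℝ) / 2) := by
    rw [← Real.sqrt_eq_rpow]
    refine Real.sqrt_le_iff.2 ⟨by positivity, ?_⟩
    rw [mul_pow, Real.sq_sqrt (Real.log_nonneg (by linarith))]
    linarith [Real.log_nonneg (by linarith : (1 : ℝ) ≤ n)]
  rw [ENNReal.ofReal_le_iff_le_toReal (measure_ne_top _ _)]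
  refine le_trans ?_ hb
  have h1 : C * (Real.sqrt ℓ * r⁻¹) ≤ 2 * C * Real.log n ^ ((1 : ℝ) / 2) / r := by
    rw [div_eq_mul_inv, ← mul_assoc]
    refine mul_le_mul_of_nonneg_right ?_ (by positivity)
    have := mul_le_mul_of_nonneg_left hsq hC.le
    linarith
  linarith
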